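/- arXiv:1311.4856 — 2 statements merged into one kernel-verified Lean document; each statement's English description precedes it below -/
import Mathlib

section
/- Let Ω ⊂ ℝ^N be a smooth bounded open set and let w ∈ W_0^{1,1}(Ω) be such that Δw, computed in the sense of distributions, is a finite Borel measure in Ω. If w is nonnegative, then for every nonnegative function ψ ∈ C^∞(Ω̄) one has ∫_Ω ψ d(Δw) ≤ ∫_Ω w Δψ. -/
open MeasureTheory Filter Metric
open scoped ENNReal Topology

noncomputable section

variable {N : ℕ}

/-- The Laplacian of a function on Euclidean space, as the sum of
second partial derivatives. -/
def lap (φ : EuclideanSpace ℝ (Fin N) → ℝ) (x : EuclideanSpace ℝ (Fin N)) : ℝ :=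
  ∑ i : Fin N, iteratedFDeriv ℝ 2 φ x
    ![EuclideanSpace.single i 1, EuclideanSpace.single i 1]

/-- Smooth functions compactly supported in `Ω`, i.e. `C_c^∞(Ω)`. -/
def IsTestFun (Ω : Set (EuclideanSpace ℝ (Fin N)))
    (φ : EuclideanSpace ℝ (Fin N) → ℝ) : Prop :=
  ContDiff ℝ (⊤ : ℕ∞) φ ∧ HasCompactSupport φ ∧ tsupport φ ⊆ Ω

/-- `Ω` is a smooth bounded open set: it is open, bounded, and is the sublevel set of a
smooth function whose gradient does not vanish on the boundary `∂Ω = {f = 0}`. -/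
def SmoothBoundedDomain (Ω : Set (EuclideanSpace ℝ (Fin N))) : Prop :=
  IsOpen Ω ∧ Bornology.IsBounded Ω ∧
  ∃ f : EuclideanSpace ℝ (Fin N) → ℝ, ContDiff ℝ (⊤ : ℕ∞) f ∧ Ω = {x | f x < 0} ∧
    frontier Ω = {x | f x = 0} ∧ ∀ x ∈ frontier Ω, fderiv ℝ f x ≠ 0

/-- The integral of `ζ` against a finite signed measure `σ`, via its Jordan decomposition. -/
def signedIntegral (σ : SignedMeasure (EuclideanSpace ℝ (Fin N)))
    (ζ : EuclideanSpace ℝ (Fin N) → ℝ) : ℝ :=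
  ∫ x, ζ x ∂σ.toJordanDecomposition.posPart - ∫ x, ζ x ∂σ.toJordanDecomposition.negPart

/-- `w` belongs to `W_0^{1,1}(Ω)`: `w ∈ L¹(Ω)` and there is a sequence of `C_c^∞(Ω)`
functions converging to `w` in `L¹(Ω)` whose gradients converge in `L¹(Ω)`. -/
def MemW011 (Ω : Set (EuclideanSpace ℝ (Fin N))) (w : EuclideanSpace ℝ (Fin N) → ℝ) : Prop :=
  Integrable w (volume.restrict Ω) ∧
  ∃ (φ : ℕ → EuclideanSpace ℝ (Fin N) → ℝ)
    (g : EuclideanSpace ℝ (Fin N) → EuclideanSpace ℝ (Fin N)),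
    Integrable g (volume.restrict Ω) ∧
    (∀ n, IsTestFun Ω (φ n)) ∧
    Tendsto (fun n => ∫ x in Ω, |φ n x - w x|) atTop (𝓝 0) ∧
    Tendsto (fun n => ∫ x in Ω, ‖gradient (φ n) x - g x‖) atTop (𝓝 0)

/-- The `i`-th partial derivative of a function on Euclidean space. -/
def partialD (i : Fin N) (u : EuclideanSpace ℝ (Fin N) → ℝ) (x : EuclideanSpace ℝ (Fin N)) : ℝ :=
  fderiv ℝ u x (EuclideanSpace.single i 1)

theorem contDiff_partialD (i : Fin N) {u : EuclideanSpace ℝ (Fin N) → ℝ}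
    (hu : ContDiff ℝ (⊤ : ℕ∞) u) : ContDiff ℝ (⊤ : ℕ∞) (partialD i u) :=
  (hu.fderiv_right (m := (⊤ : ℕ∞)) (by simp)).clm_apply contDiff_const

theorem ContDiff.differentiable_of_top {u : EuclideanSpace ℝ (Fin N) → ℝ}
    (hu : ContDiff ℝ (⊤ : ℕ∞) u) : Differentiable ℝ u :=
  hu.differentiable (by simp)

theorem partialD_mul (i : Fin N) {u v : EuclideanSpace ℝ (Fin N) → ℝ}
    (hu : Differentiable ℝ u) (hv : Differentiable ℝ v) :
    partialD i (fun x => u x * v x) = fun x => u x * partialD i v x + v x * partialD i u x := by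
  funext x
  simp [partialD, fderiv_fun_mul (hu x) (hv x)]

theorem partialD_sub (i : Fin N) {u v : EuclideanSpace ℝ (Fin N) → ℝ}
    (hu : Differentiable ℝ u) (hv : Differentiable ℝ v) :
    partialD i (fun x => u x - v x) = fun x => partialD i u x - partialD i v x := by
  funext x
  simp [partialD, fderiv_fun_sub (hu x) (hv x)]

theorem partialD_add (i : Fin N) {u v : EuclideanSpace ℝ (Fin N) → ℝ}
    (hu : Differentiable ℝ u) (hv : Differentiable ℝ v) :
    partialD i (fun x => u x + v x) = fun x => partialD i u x + partialD i v x := by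
  funext x
  simp [partialD, fderiv_fun_add (hu x) (hv x)]

theorem partialD_comp (i : Fin N) {h : ℝ → ℝ} {u : EuclideanSpace ℝ (Fin N) → ℝ}
    (hh : Differentiable ℝ h) (hu : Differentiable ℝ u) :
    partialD i (fun x => h (u x)) = fun x => deriv h (u x) * partialD i u x := by
  funext x
  have := ((hh (u x)).hasDerivAt.comp_hasFDerivAt x (hu x).hasFDerivAt).fderiv
  change fderiv ℝ (h ∘ u) x _ = _
  rw [this]
  simp [partialD]

theorem partialD_const_mul (i : Fin N) (c : ℝ) {u : EuclideanSpace ℝ (Fin N) → ℝ}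
    (hu : Differentiable ℝ u) :
    partialD i (fun x => c * u x) = fun x => c * partialD i u x := by
  funext x
  have := ((hu x).hasFDerivAt.const_mul c).fderiv
  simp [partialD, this]

theorem lap_eq_sum_partialD {u : EuclideanSpace ℝ (Fin N) → ℝ} (hu : ContDiff ℝ (⊤ : ℕ∞) u)
    (x : EuclideanSpace ℝ (Fin N)) : lap u x = ∑ i, partialD i (partialD i u) x := by
  have hd : Differentiable ℝ (fderiv ℝ u) :=
    (hu.fderiv_right (m := (⊤ : ℕ∞)) (by simp)).differentiable (by simp)
  unfold lap
  refine Finset.sum_congr rfl fun i _ => ?_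
  rw [iteratedFDeriv_two_apply]
  have := fderiv_clm_apply (hd x)
    (differentiableAt_const (EuclideanSpace.single i (1 : ℝ) : EuclideanSpace ℝ (Fin N)))
  change _ = fderiv ℝ (fun y => (fderiv ℝ u y) (EuclideanSpace.single i 1)) x _
  rw [this]
  simp

theorem continuous_lap {u : EuclideanSpace ℝ (Fin N) → ℝ} (hu : ContDiff ℝ (⊤ : ℕ∞) u) :
    Continuous (lap u) := by
  rw [funext (lap_eq_sum_partialD hu)]
  exact continuous_finsetSum _ fun i _ =>
    (contDiff_partialD i (contDiff_partialD i hu)).continuous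

theorem lap_sub {u v : EuclideanSpace ℝ (Fin N) → ℝ} (hu : ContDiff ℝ (⊤ : ℕ∞) u)
    (hv : ContDiff ℝ (⊤ : ℕ∞) v) (x : EuclideanSpace ℝ (Fin N)) :
    lap (fun y => u y - v y) x = lap u x - lap v x := by
  rw [lap_eq_sum_partialD (hu.sub hv), lap_eq_sum_partialD hu, lap_eq_sum_partialD hv,
    ← Finset.sum_sub_distrib]
  refine Finset.sum_congr rfl fun i _ => ?_
  rw [partialD_sub i hu.differentiable_of_top hv.differentiable_of_top,
    partialD_sub i (contDiff_partialD i hu).differentiable_of_top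
      (contDiff_partialD i hv).differentiable_of_top]

theorem lap_mul {u v : EuclideanSpace ℝ (Fin N) → ℝ} (hu : ContDiff ℝ (⊤ : ℕ∞) u)
    (hv : ContDiff ℝ (⊤ : ℕ∞) v) (x : EuclideanSpace ℝ (Fin N)) :
    lap (fun y => u y * v y) x =
      u x * lap v x + 2 * ∑ i, partialD i u x * partialD i v x + v x * lap u x := by
  rw [lap_eq_sum_partialD (hu.mul hv), lap_eq_sum_partialD hu, lap_eq_sum_partialD hv,
    Finset.mul_sum, Finset.mul_sum, Finset.mul_sum, ← Finset.sum_add_distrib,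
    ← Finset.sum_add_distrib]
  refine Finset.sum_congr rfl fun i _ => ?_
  have hu' := contDiff_partialD i hu
  have hv' := contDiff_partialD i hv
  rw [partialD_mul i hu.differentiable_of_top hv.differentiable_of_top,
    partialD_add i (hu.mul hv').differentiable_of_top (hv.mul hu').differentiable_of_top,
    partialD_mul i hu.differentiable_of_top hv'.differentiable_of_top,
    partialD_mul i hv.differentiable_of_top hu'.differentiable_of_top]
  ring

theorem contDiff_exp_mul (k : ℝ) {f : EuclideanSpace ℝ (Fin N) → ℝ}
    (hf : ContDiff ℝ (⊤ : ℕ∞) f) : ContDiff ℝ (⊤ : ℕ∞) (fun x => Real.exp (k * f x)) :=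
  (contDiff_const.mul hf).exp

theorem partialD_exp_mul (i : Fin N) (k : ℝ) {f : EuclideanSpace ℝ (Fin N) → ℝ}
    (hf : Differentiable ℝ f) :
    partialD i (fun x => Real.exp (k * f x)) =
      fun x => Real.exp (k * f x) * (k * partialD i f x) := by
  funext x
  have := ((hf x).hasFDerivAt.const_mul k).exp.fderiv
  simp [partialD, this]

theorem lap_exp_mul (k : ℝ) {f : EuclideanSpace ℝ (Fin N) → ℝ}
    (hf : ContDiff ℝ (⊤ : ℕ∞) f) (x : EuclideanSpace ℝ (Fin N)) :
    lap (fun x => Real.exp (k * f x)) x =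
      Real.exp (k * f x) * (k * lap f x + k ^ 2 * ∑ i, partialD i f x ^ 2) := by
  have he := contDiff_exp_mul k hf
  rw [lap_eq_sum_partialD he, lap_eq_sum_partialD hf, Finset.mul_sum, Finset.mul_sum,
    ← Finset.sum_add_distrib, Finset.mul_sum]
  refine Finset.sum_congr rfl fun i _ => ?_
  have hf' := contDiff_partialD i hf
  have hkf' : Differentiable ℝ (fun x => k * partialD i f x) :=
    hf'.differentiable_of_top.const_mul k
  rw [partialD_exp_mul i k hf.differentiable_of_top,
    partialD_mul i he.differentiable_of_top hkf',
    partialD_exp_mul i k hf.differentiable_of_top]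
  simp only [partialD_const_mul i k hf'.differentiable_of_top]
  ring

theorem gradient_apply_eq_partialD {u : EuclideanSpace ℝ (Fin N) → ℝ}
    (x : EuclideanSpace ℝ (Fin N)) (i : Fin N) : gradient u x i = partialD i u x := by
  have : inner ℝ (gradient u x) (EuclideanSpace.single i 1) = partialD i u x := by
    simp [gradient, partialD]
  rw [← this, EuclideanSpace.inner_single_right]
  simp

theorem sum_partialD_sq_pos {u : EuclideanSpace ℝ (Fin N) → ℝ} {x : EuclideanSpace ℝ (Fin N)}
    (hx : fderiv ℝ u x ≠ 0) : 0 < ∑ i, partialD i u x ^ 2 := by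
  refine (Finset.sum_nonneg fun i _ => sq_nonneg _).lt_of_ne fun h => hx ?_
  have h0 := (Finset.sum_eq_zero_iff_of_nonneg fun i _ => sq_nonneg _).1 h.symm
  refine ContinuousLinearMap.coe_injective
    ((EuclideanSpace.basisFun (Fin N) ℝ).toBasis.ext fun i => ?_)
  simpa [partialD] using h0 i (Finset.mem_univ i)

theorem exists_bound_of_isBounded {Ω : Set (EuclideanSpace ℝ (Fin N))}
    (hb : Bornology.IsBounded Ω) {v : EuclideanSpace ℝ (Fin N) → ℝ} (hv : Continuous v) :
    ∃ M, 0 ≤ M ∧ ∀ x ∈ Ω, |v x| ≤ M := by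
  obtain ⟨M, hM⟩ := hb.isCompact_closure.exists_bound_of_continuousOn hv.continuousOn
  exact ⟨max M 0, le_max_right _ _, fun x hx => (hM x (subset_closure hx)).trans (le_max_left _ _)⟩

theorem integrable_mul_of_bounded_on {Ω : Set (EuclideanSpace ℝ (Fin N))}
    {μ : Measure (EuclideanSpace ℝ (Fin N))} (hμ : ∀ᵐ x ∂μ, x ∈ Ω)
    {a v : EuclideanSpace ℝ (Fin N) → ℝ} (ha : Integrable a μ) (hv : Continuous v)
    {M : ℝ} (hM : ∀ x ∈ Ω, |v x| ≤ M) : Integrable (fun x => a x * v x) μ :=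
  ha.mul_bdd hv.aestronglyMeasurable (hμ.mono hM)

theorem tendsto_integral_mul_of_bounded_on {Ω : Set (EuclideanSpace ℝ (Fin N))}
    {μ : Measure (EuclideanSpace ℝ (Fin N))} (hμ : ∀ᵐ x ∂μ, x ∈ Ω)
    {a : EuclideanSpace ℝ (Fin N) → ℝ} (ha : Integrable a μ)
    {v : ℕ → EuclideanSpace ℝ (Fin N) → ℝ} {v' : EuclideanSpace ℝ (Fin N) → ℝ}
    (hv : ∀ n, Continuous (v n)) {M : ℝ} (hM : ∀ n, ∀ x ∈ Ω, |v n x| ≤ M)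
    (hlim : ∀ x ∈ Ω, Tendsto (fun n => v n x) atTop (𝓝 (v' x))) :
    Tendsto (fun n => ∫ x, a x * v n x ∂μ) atTop (𝓝 (∫ x, a x * v' x ∂μ)) := by
  refine tendsto_integral_of_dominated_convergence (fun x => |a x| * M)
    (fun n => ha.aestronglyMeasurable.mul (hv n).aestronglyMeasurable)
    (ha.abs.mul_const M) (fun n => ?_) ?_
  · filter_upwards [hμ] with x hx
    rw [Real.norm_eq_abs, abs_mul]
    exact mul_le_mul_of_nonneg_left (hM n x hx) (abs_nonneg _)
  · filter_upwards [hμ] with x hx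
    exact (hlim x hx).const_mul _

theorem tendsto_signedIntegral_of_bounded_on {Ω : Set (EuclideanSpace ℝ (Fin N))}
    {ν : SignedMeasure (EuclideanSpace ℝ (Fin N))} (hν : ν.totalVariation Ωᶜ = 0)
    {v : ℕ → EuclideanSpace ℝ (Fin N) → ℝ} {v' : EuclideanSpace ℝ (Fin N) → ℝ}
    (hv : ∀ n, Continuous (v n)) {M : ℝ} (hM : ∀ n, ∀ x ∈ Ω, |v n x| ≤ M)
    (hlim : ∀ x ∈ Ω, Tendsto (fun n => v n x) atTop (𝓝 (v' x))) :
    Tendsto (fun n => signedIntegral ν (v n)) atTop (𝓝 (signedIntegral ν v')) := by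
  rw [SignedMeasure.totalVariation, Measure.add_apply, add_eq_zero] at hν
  have key : ∀ (μ : Measure (EuclideanSpace ℝ (Fin N))) [IsFiniteMeasure μ], μ Ωᶜ = 0 →
      Tendsto (fun n => ∫ x, v n x ∂μ) atTop (𝓝 (∫ x, v' x ∂μ)) := fun μ _ hμ => by
    simpa using tendsto_integral_mul_of_bounded_on (a := fun _ => 1) (mem_ae_iff.2 hμ)
      (integrable_const 1) hv hM hlim
  exact (key _ hν.1).sub (key _ hν.2)

theorem tendsto_integral_mul_of_tendsto_L1 {Ω : Set (EuclideanSpace ℝ (Fin N))}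
    {μ : Measure (EuclideanSpace ℝ (Fin N))} (hμ : ∀ᵐ x ∂μ, x ∈ Ω)
    {a : ℕ → EuclideanSpace ℝ (Fin N) → ℝ} {a' v : EuclideanSpace ℝ (Fin N) → ℝ}
    (ha : ∀ n, Integrable (a n) μ) (ha' : Integrable a' μ)
    (hlim : Tendsto (fun n => ∫ x, |a n x - a' x| ∂μ) atTop (𝓝 0))
    (hv : Continuous v) {M : ℝ} (hM : ∀ x ∈ Ω, |v x| ≤ M) :
    Tendsto (fun n => ∫ x, a n x * v x ∂μ) atTop (𝓝 (∫ x, a' x * v x ∂μ)) := by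
  rw [tendsto_iff_norm_sub_tendsto_zero]
  refine squeeze_zero (fun _ => norm_nonneg _) (fun n => ?_) (by simpa using hlim.mul_const M)
  rw [← integral_sub (integrable_mul_of_bounded_on hμ (ha n) hv hM)
    (integrable_mul_of_bounded_on hμ ha' hv hM), ← integral_mul_const]
  refine norm_integral_le_of_norm_le (((ha n).sub ha').abs.mul_const M) ?_
  filter_upwards [hμ] with x hx
  rw [← sub_mul, norm_mul]
  exact mul_le_mul_of_nonneg_left (hM x hx) (abs_nonneg _)

/-- A function in `W_0^{1,1}(Ω)` admits an integrable weak gradient, and integration by parts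
against functions smooth up to the boundary produces no boundary term. -/
theorem MemW011.exists_weak_gradient {Ω : Set (EuclideanSpace ℝ (Fin N))} (hΩ : IsOpen Ω)
    (hb : Bornology.IsBounded Ω) {w : EuclideanSpace ℝ (Fin N) → ℝ} (hw : MemW011 Ω w) :
    ∃ g : Fin N → EuclideanSpace ℝ (Fin N) → ℝ,
      (∀ i, Integrable (g i) (volume.restrict Ω)) ∧
      ∀ (i : Fin N) (u : EuclideanSpace ℝ (Fin N) → ℝ), ContDiff ℝ (⊤ : ℕ∞) u →
        ∫ x in Ω, w x * partialD i u x = - ∫ x in Ω, g i x * u x := by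
  obtain ⟨hwi, φ, g, hg, hφ, hlim, hlim'⟩ := hw
  have hae : ∀ᵐ x ∂(volume.restrict Ω), x ∈ Ω := ae_restrict_mem hΩ.measurableSet
  have hgi : ∀ i, Integrable (fun x => g x i) (volume.restrict Ω) := fun i =>
    (EuclideanSpace.proj i : EuclideanSpace ℝ (Fin N) →L[ℝ] ℝ).integrable_comp hg
  refine ⟨fun i x => g x i, hgi, fun i u hu => ?_⟩
  have hDs : ∀ n, HasCompactSupport (partialD i (φ n)) := fun n =>
    (hφ n).2.1.fderiv_apply (𝕜 := ℝ) (EuclideanSpace.single i 1)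
  have hDc : ∀ n, Continuous (partialD i (φ n)) := fun n =>
    (contDiff_partialD i (hφ n).1).continuous
  have hDi : ∀ n, Integrable (partialD i (φ n)) volume := fun n =>
    (hDc n).integrable_of_hasCompactSupport (hDs n)
  have huc' := (contDiff_partialD i hu).continuous
  obtain ⟨M, -, hM⟩ := exists_bound_of_isBounded hb hu.continuous
  obtain ⟨M', -, hM'⟩ := exists_bound_of_isBounded hb huc'
  have hφi : ∀ n, Integrable (φ n) volume := fun n =>
    (hφ n).1.continuous.integrable_of_hasCompactSupport (hφ n).2.1
  have h1 := tendsto_integral_mul_of_tendsto_L1 hae (fun n => (hφi n).restrict) hwi hlim huc' hM'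
  have hlimi : Tendsto (fun n => ∫ x in Ω, |partialD i (φ n) x - g x i|) atTop (𝓝 0) := by
    refine squeeze_zero (fun n => integral_nonneg fun x => abs_nonneg _) (fun n => ?_) hlim'
    have hgr : Integrable (gradient (φ n)) (volume.restrict Ω) := by
      have hc : Continuous (gradient (φ n)) :=
        (InnerProductSpace.toDual ℝ _).symm.continuous.comp
          ((hφ n).1.continuous_fderiv (by simp))
      refine (hc.integrable_of_hasCompactSupport ?_).restrict
      exact ((hφ n).2.1.fderiv (𝕜 := ℝ)).comp_left (map_zero _)
    refine integral_mono ((hDi n).restrict.sub (hgi i)).abs (hgr.sub hg).norm fun x => ?_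
    have := PiLp.norm_apply_le (gradient (φ n) x - g x) i
    simpa [gradient_apply_eq_partialD] using this
  have h2 := tendsto_integral_mul_of_tendsto_L1 hae (fun n => (hDi n).restrict) (hgi i) hlimi
    hu.continuous hM
  refine tendsto_nhds_unique h1 (h2.neg.congr fun n => ?_)
  have hz : ∀ x ∉ Ω, φ n x = 0 := fun x hx =>
    image_eq_zero_of_notMem_tsupport fun h => hx ((hφ n).2.2 h)
  have hz' : ∀ x ∉ Ω, partialD i (φ n) x = 0 := fun x hx => by
    have : fderiv ℝ (φ n) x = 0 := by
      by_contra h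
      exact hx ((hφ n).2.2 (support_fderiv_subset ℝ h))
    simp [partialD, this]
  rw [setIntegral_eq_integral_of_forall_compl_eq_zero fun x hx => by rw [hz' x hx, zero_mul],
    setIntegral_eq_integral_of_forall_compl_eq_zero fun x hx => by rw [hz x hx, zero_mul]]
  refine (integral_mul_fderiv_eq_neg_fderiv_mul_of_integrable (𝕜 := ℝ) ?_ ?_ ?_
    (fun x _ => (hφ n).1.differentiable_of_top x) fun x _ => hu.differentiable_of_top x).symm
  · exact ((hDc n).mul hu.continuous).integrable_of_hasCompactSupport (hDs n).mul_right
  · exact ((hφ n).1.continuous.mul huc').integrable_of_hasCompactSupport (hφ n).2.1.mul_right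
  · exact ((hφ n).1.continuous.mul hu.continuous).integrable_of_hasCompactSupport
      (hφ n).2.1.mul_right

theorem integral_mul_lap_eq_neg_sum {Ω : Set (EuclideanSpace ℝ (Fin N))} (hΩ : IsOpen Ω)
    (hb : Bornology.IsBounded Ω) {w : EuclideanSpace ℝ (Fin N) → ℝ}
    (hw : Integrable w (volume.restrict Ω)) {g : Fin N → EuclideanSpace ℝ (Fin N) → ℝ}
    (hwg : ∀ (i : Fin N) (u : EuclideanSpace ℝ (Fin N) → ℝ), ContDiff ℝ (⊤ : ℕ∞) u →
        ∫ x in Ω, w x * partialD i u x = - ∫ x in Ω, g i x * u x)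
    {u : EuclideanSpace ℝ (Fin N) → ℝ} (hu : ContDiff ℝ (⊤ : ℕ∞) u) :
    ∫ x in Ω, w x * lap u x = - ∑ i, ∫ x in Ω, g i x * partialD i u x := by
  simp_rw [lap_eq_sum_partialD hu, Finset.mul_sum]
  rw [integral_finsetSum, ← Finset.sum_neg_distrib]
  · exact Finset.sum_congr rfl fun i _ => hwg i _ (contDiff_partialD i hu)
  · intro i _
    have hc := (contDiff_partialD i (contDiff_partialD i hu)).continuous
    obtain ⟨M, -, hM⟩ := exists_bound_of_isBounded hb hc
    exact integrable_mul_of_bounded_on (ae_restrict_mem hΩ.measurableSet) hw hc hM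

/-- A smooth cutoff: `0` on `(-∞, 1]`, `1` on `[2, ∞)`. -/
theorem exists_smooth_cutoff : ∃ χ : ℝ → ℝ, ContDiff ℝ (⊤ : ℕ∞) χ ∧ (∀ t, |χ t| ≤ 1) ∧
    (∀ t ≤ 1, χ t = 0) ∧ (∀ t, 2 ≤ t → χ t = 1) ∧ (∀ t, 2 < t → deriv χ t = 0) ∧
    ∃ C, ∀ t, |t * deriv χ t| ≤ C := by
  have hs : ContDiff ℝ (⊤ : ℕ∞) fun t : ℝ => Real.smoothTransition (t - 1) :=
    Real.smoothTransition.contDiff.comp (contDiff_id.sub contDiff_const)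
  have h1 : ∀ t : ℝ, 2 ≤ t → Real.smoothTransition (t - 1) = 1 := fun t ht =>
    Real.smoothTransition.one_of_one_le (by linarith)
  have h0 : ∀ t : ℝ, t ≤ 1 → Real.smoothTransition (t - 1) = 0 := fun t ht =>
    Real.smoothTransition.zero_of_nonpos (by linarith)
  have hd : ∀ t : ℝ, 2 < t → deriv (fun t : ℝ => Real.smoothTransition (t - 1)) t = 0 :=
    fun t ht => by
      rw [(show (fun t : ℝ => Real.smoothTransition (t - 1)) =ᶠ[𝓝 t] fun _ => 1 from
        (lt_mem_nhds ht).mono fun s hs => h1 s hs.le).deriv_eq, deriv_const]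
  have hd' : ∀ t : ℝ, t < 1 → deriv (fun t : ℝ => Real.smoothTransition (t - 1)) t = 0 :=
    fun t ht => by
      rw [(show (fun t : ℝ => Real.smoothTransition (t - 1)) =ᶠ[𝓝 t] fun _ => 0 from
        (gt_mem_nhds ht).mono fun s hs => h0 s hs.le).deriv_eq, deriv_const]
  refine ⟨_, hs, fun t => ?_, h0, h1, hd, ?_⟩
  · rw [abs_of_nonneg (Real.smoothTransition.nonneg _)]
    exact Real.smoothTransition.le_one _
  · obtain ⟨C, hC⟩ := (isCompact_Icc (a := (1 : ℝ)) (b := 2)).exists_bound_of_continuousOn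
      (continuous_id.mul (hs.continuous_deriv (by simp))).continuousOn
    refine ⟨max C 0, fun t => ?_⟩
    by_cases h : t ∈ Set.Icc (1 : ℝ) 2
    · exact (hC t h).trans (le_max_left _ _)
    · have : deriv (fun t : ℝ => Real.smoothTransition (t - 1)) t = 0 := by
        by_cases h' : t < 1
        · exact hd' t h'
        · exact hd t (by by_contra h2; exact h ⟨by linarith, by linarith⟩)
      simp [this]

theorem eventually_lt_nat_mul {s : ℝ} (hs : 0 < s) (a : ℝ) : ∀ᶠ n : ℕ in atTop, a < n * s :=
  (tendsto_natCast_atTop_atTop.atTop_mul_const hs).eventually_gt_atTop a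

/-- The distributional identity `Δw = ν` extends to smooth test functions that are merely
dominated by a multiple of the defining function of `Ω`. -/
theorem integral_mul_lap_eq_signedIntegral_of_abs_le {Ω : Set (EuclideanSpace ℝ (Fin N))}
    (hΩ : IsOpen Ω) (hb : Bornology.IsBounded Ω) {f : EuclideanSpace ℝ (Fin N) → ℝ}
    (hf : ContDiff ℝ (⊤ : ℕ∞) f) (hΩf : Ω = {x | f x < 0})
    {w : EuclideanSpace ℝ (Fin N) → ℝ}
    (hw : Integrable w (volume.restrict Ω)) {g : Fin N → EuclideanSpace ℝ (Fin N) → ℝ}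
    (hg : ∀ i, Integrable (g i) (volume.restrict Ω))
    (hwg : ∀ (i : Fin N) (u : EuclideanSpace ℝ (Fin N) → ℝ), ContDiff ℝ (⊤ : ℕ∞) u →
        ∫ x in Ω, w x * partialD i u x = - ∫ x in Ω, g i x * u x)
    {ν : SignedMeasure (EuclideanSpace ℝ (Fin N))} (hν : ν.totalVariation Ωᶜ = 0)
    (hνlap : ∀ φ : EuclideanSpace ℝ (Fin N) → ℝ, IsTestFun Ω φ →
      ∫ x in Ω, w x * lap φ x = signedIntegral ν φ)
    {F : EuclideanSpace ℝ (Fin N) → ℝ} (hF : ContDiff ℝ (⊤ : ℕ∞) F)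
    {K : ℝ} (hFK : ∀ x ∈ Ω, |F x| ≤ K * |f x|) :
    ∫ x in Ω, w x * lap F x = signedIntegral ν F := by
  have hae : ∀ᵐ x ∂(volume.restrict Ω), x ∈ Ω := ae_restrict_mem hΩ.measurableSet
  obtain ⟨χ, hχ, hχ1, hχ0, hχe, hχd, C, hC⟩ := exists_smooth_cutoff
  have hneg : ∀ x ∈ Ω, 0 < -f x := fun x hx => by
    rw [hΩf] at hx
    exact neg_pos.2 hx
  have hs : ∀ n : ℕ, ContDiff ℝ (⊤ : ℕ∞) fun x => (n : ℝ) * -f x := fun n =>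
    contDiff_const.mul hf.neg
  have hcut : ∀ n : ℕ, ContDiff ℝ (⊤ : ℕ∞) fun x => χ (n * -f x) := fun n => hχ.comp (hs n)
  have htest : ∀ n : ℕ, IsTestFun Ω fun x => F x * χ (n * -f x) := fun n => by
    have hsub : tsupport (fun x => F x * χ (n * -f x)) ⊆ {x | 1 ≤ n * -f x} := by
      refine closure_minimal (fun x hx => ?_)
        (isClosed_le continuous_const (hs n).continuous)
      by_contra h
      exact hx (by simp only [hχ0 _ (not_le.1 h).le, mul_zero])
    have hsub' : tsupport (fun x => F x * χ (n * -f x)) ⊆ Ω := fun x hx => by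
      rw [hΩf]
      have h1 : 1 ≤ n * -f x := hsub hx
      by_contra h
      have h2 : 0 ≤ f x := not_lt.1 h
      nlinarith [mul_nonneg (Nat.cast_nonneg (α := ℝ) n) h2]
    exact ⟨hF.mul (hcut n),
      isCompact_of_isClosed_isBounded (isClosed_tsupport _) (hb.subset hsub'), hsub'⟩
  obtain ⟨MF, hMF0, hMF⟩ := exists_bound_of_isBounded hb hF.continuous
  have hlimcut : ∀ x ∈ Ω, ∀ᶠ n : ℕ in atTop, 2 < n * -f x := fun x hx =>
    eventually_lt_nat_mul (hneg x hx) 2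
  have hright : Tendsto (fun n : ℕ => signedIntegral ν fun x => F x * χ (n * -f x)) atTop
      (𝓝 (signedIntegral ν F)) := by
    refine tendsto_signedIntegral_of_bounded_on hν
      (fun n => (hF.mul (hcut n)).continuous) (M := MF) (fun n x hx => ?_) fun x hx => ?_
    · rw [abs_mul]
      exact (mul_le_of_le_one_right (abs_nonneg _) (hχ1 _)).trans (hMF x hx)
    · refine tendsto_const_nhds.congr' ?_
      filter_upwards [hlimcut x hx] with n hn
      rw [hχe _ hn.le, mul_one]
  have hpart : ∀ (i : Fin N) (n : ℕ), partialD i (fun x => F x * χ (n * -f x)) =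
      fun x => F x * (deriv χ (n * -f x) * -(n * partialD i f x)) +
        χ (n * -f x) * partialD i F x := fun i n => by
    rw [partialD_mul i hF.differentiable_of_top (hcut n).differentiable_of_top,
      partialD_comp i (hχ.differentiable (by simp)) (hs n).differentiable_of_top]
    have : partialD i (fun x => (n : ℝ) * -f x) = fun x => -(n * partialD i f x) := by
      rw [partialD_const_mul i n hf.differentiable_of_top.fun_neg]
      funext x
      simp [partialD, fderiv_fun_neg]
    simp only [this]
  have hleft : Tendsto (fun n : ℕ => ∫ x in Ω, w x * lap (fun x => F x * χ (n * -f x)) x) atTop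
      (𝓝 (∫ x in Ω, w x * lap F x)) := by
    rw [integral_mul_lap_eq_neg_sum hΩ hb hw hwg hF]
    simp_rw [fun n : ℕ => integral_mul_lap_eq_neg_sum hΩ hb hw hwg (htest n).1]
    refine (tendsto_finsetSum _ fun i _ => ?_).neg
    obtain ⟨M1, hM10, hM1⟩ := exists_bound_of_isBounded hb (contDiff_partialD i hf).continuous
    obtain ⟨M2, hM20, hM2⟩ := exists_bound_of_isBounded hb (contDiff_partialD i hF).continuous
    refine tendsto_integral_mul_of_bounded_on hae (hg i)
      (fun n => (contDiff_partialD i (htest n).1).continuous)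
      (M := |K| * C * M1 + M2) (fun n x hx => ?_) fun x hx => ?_
    · simp only [hpart]
      refine (abs_add_le _ _).trans (add_le_add ?_ ?_)
      · have h1 : |n * f x * deriv χ (n * -f x)| ≤ C := by
          have := hC (n * -f x)
          rwa [mul_neg, neg_mul, abs_neg, ← mul_neg] at this
        have h2 : |F x| ≤ |K| * |f x| :=
          (hFK x hx).trans (mul_le_mul_of_nonneg_right (le_abs_self K) (abs_nonneg _))
        calc |F x * (deriv χ (n * -f x) * -(n * partialD i f x))|
            = |F x| * (|deriv χ (n * -f x)| * (n * |partialD i f x|)) := by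
              rw [abs_mul, abs_mul, abs_neg, abs_mul, Nat.abs_cast]
          _ ≤ (|K| * |f x|) * (|deriv χ (n * -f x)| * (n * |partialD i f x|)) := by gcongr
          _ = |K| * |n * f x * deriv χ (n * -f x)| * |partialD i f x| := by
              rw [abs_mul, abs_mul, Nat.abs_cast]
              ring
          _ ≤ |K| * C * M1 := by
              have := hM1 x hx
              have : 0 ≤ C := (abs_nonneg _).trans h1
              gcongr
      · rw [abs_mul]
        exact (mul_le_of_le_one_left (abs_nonneg _) (hχ1 _)).trans (hM2 x hx)
    · refine tendsto_const_nhds.congr' ?_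
      filter_upwards [hlimcut x hx] with n hn
      rw [hpart]
      simp only [hχe _ hn.le, hχd _ hn, zero_mul, mul_zero, zero_add, one_mul]
  exact tendsto_nhds_unique hleft (hright.congr fun n => (hνlap _ (htest n)).symm)

theorem exp_nat_mul_le_one {t : ℝ} (ht : t < 0) (k : ℕ) : |Real.exp (k * t)| ≤ 1 := by
  rw [abs_of_pos (Real.exp_pos _)]
  exact Real.exp_le_one_iff.2 (mul_nonpos_of_nonneg_of_nonpos (Nat.cast_nonneg k) ht.le)

theorem tendsto_exp_nat_mul_of_neg {t : ℝ} (ht : t < 0) :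
    Tendsto (fun k : ℕ => Real.exp (k * t)) atTop (𝓝 0) :=
  Real.tendsto_exp_atBot.comp (tendsto_natCast_atTop_atTop.atTop_mul_const_of_neg ht)

theorem tendsto_nat_mul_exp_mul_neg {t : ℝ} (ht : t < 0) :
    Tendsto (fun k : ℕ => k * Real.exp (k * t) * -t) atTop (𝓝 0) := by
  have h := (Real.tendsto_pow_mul_exp_neg_atTop_nhds_zero 1).comp
    (tendsto_natCast_atTop_atTop (R := ℝ).atTop_mul_const (neg_pos.2 ht))
  refine h.congr fun k => ?_
  simp only [Function.comp, pow_one, mul_neg, neg_neg]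
  ring

theorem abs_nat_mul_exp_mul_neg_le_one {t : ℝ} (ht : t < 0) (k : ℕ) :
    |k * Real.exp (k * t) * -t| ≤ 1 := by
  have h0 : 0 ≤ (k : ℝ) * -t := mul_nonneg (Nat.cast_nonneg k) (neg_pos.2 ht).le
  have hp := Real.exp_pos (k * t)
  have h1 : (k : ℝ) * -t ≤ Real.exp (k * -t) := by linarith [Real.add_one_le_exp (k * -t)]
  have h2 : Real.exp (k * t) * Real.exp (k * -t) = 1 := by
    rw [← Real.exp_add, mul_neg, add_neg_cancel, Real.exp_zero]
  rw [show k * Real.exp (k * t) * -t = Real.exp (k * t) * (k * -t) by ring,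
    abs_of_nonneg (mul_nonneg hp.le h0), ← h2]
  exact mul_le_mul_of_nonneg_left h1 hp.le

theorem abs_one_sub_exp_nat_mul_le {t : ℝ} (ht : t < 0) (k : ℕ) :
    |1 - Real.exp (k * t)| ≤ k * |t| := by
  have h := exp_nat_mul_le_one ht k
  rw [abs_of_pos (Real.exp_pos _)] at h
  rw [abs_of_nonneg (by linarith), abs_of_neg ht]
  linarith [Real.add_one_le_exp (k * t)]

/-- Boundary layers `k e^{kf} |∇f|²` carry no mass of a function in `W_0^{1,1}(Ω)`. -/
theorem tendsto_integral_boundary_layer {Ω : Set (EuclideanSpace ℝ (Fin N))}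
    (hΩ : IsOpen Ω) (hb : Bornology.IsBounded Ω) {f : EuclideanSpace ℝ (Fin N) → ℝ}
    (hf : ContDiff ℝ (⊤ : ℕ∞) f) (hneg : ∀ x ∈ Ω, f x < 0)
    {w : EuclideanSpace ℝ (Fin N) → ℝ}
    (hw : Integrable w (volume.restrict Ω)) {g : Fin N → EuclideanSpace ℝ (Fin N) → ℝ}
    (hg : ∀ i, Integrable (g i) (volume.restrict Ω))
    (hwg : ∀ (i : Fin N) (u : EuclideanSpace ℝ (Fin N) → ℝ), ContDiff ℝ (⊤ : ℕ∞) u →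
        ∫ x in Ω, w x * partialD i u x = - ∫ x in Ω, g i x * u x) :
    Tendsto (fun k : ℕ => ∫ x in Ω,
      w x * (k * Real.exp (k * f x) * ∑ i, partialD i f x ^ 2)) atTop (𝓝 0) := by
  have hae : ∀ᵐ x ∂(volume.restrict Ω), x ∈ Ω := ae_restrict_mem hΩ.measurableSet
  have hint : ∀ {v : EuclideanSpace ℝ (Fin N) → ℝ}, Continuous v →
      Integrable (fun x => w x * v x) (volume.restrict Ω) := fun hv => by
    obtain ⟨M, -, hM⟩ := exists_bound_of_isBounded hb hv
    exact integrable_mul_of_bounded_on hae hw hv hM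
  have he : ∀ k : ℕ, ContDiff ℝ (⊤ : ℕ∞) fun x => Real.exp (k * f x) := fun k =>
    contDiff_exp_mul k hf
  have hlim : ∀ {a v : EuclideanSpace ℝ (Fin N) → ℝ}, Integrable a (volume.restrict Ω) →
      Continuous v → Tendsto (fun k : ℕ => ∫ x in Ω, a x * (Real.exp (k * f x) * v x)) atTop
        (𝓝 0) := fun {a v} ha hv => by
    obtain ⟨M, hM0, hM⟩ := exists_bound_of_isBounded hb hv
    have := tendsto_integral_mul_of_bounded_on (v' := fun _ => 0) hae ha
      (v := fun k x => Real.exp (k * f x) * v x) (fun k => (he k).continuous.mul hv) (M := M)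
      (fun k x hx => by
        rw [abs_mul]
        exact (mul_le_of_le_one_left (abs_nonneg _) (exp_nat_mul_le_one (hneg x hx) k)).trans
          (hM x hx))
      (fun x hx => by simpa using (tendsto_exp_nat_mul_of_neg (hneg x hx)).mul_const (v x))
    simpa using this
  have hsum : Tendsto (fun k : ℕ => ∑ i, (-(∫ x in Ω, g i x * (Real.exp (k * f x) * partialD i f x))
      - ∫ x in Ω, w x * (Real.exp (k * f x) * partialD i (partialD i f) x))) atTop (𝓝 0) := by
    rw [← Finset.sum_const_zero (s := (Finset.univ : Finset (Fin N)))]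
    refine tendsto_finsetSum _ fun i _ => ?_
    have hf' := contDiff_partialD i hf
    simpa using (hlim (hg i) hf'.continuous).neg.sub
      (hlim hw (contDiff_partialD i hf').continuous)
  refine hsum.congr fun k => ?_
  simp_rw [Finset.mul_sum]
  have hf' := fun i => contDiff_partialD i hf
  have hc1 : ∀ i, Continuous fun x => k * Real.exp (k * f x) * partialD i f x ^ 2 := fun i =>
    (continuous_const.mul (he k).continuous).mul ((hf' i).continuous.pow 2)
  rw [integral_finsetSum _ fun i _ => hint (hc1 i)]
  refine Finset.sum_congr rfl fun i _ => ?_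
  have hc2 : Continuous fun x => Real.exp (k * f x) * partialD i (partialD i f) x :=
    (he k).continuous.mul (contDiff_partialD i (hf' i)).continuous
  rw [← hwg i _ ((he k).mul (hf' i)), ← integral_sub (hint (contDiff_partialD i
    ((he k).mul (hf' i))).continuous) (hint hc2)]
  refine integral_congr_ae (Eventually.of_forall fun x => ?_)
  simp only [partialD_mul i (he k).differentiable_of_top (hf' i).differentiable_of_top,
    partialD_exp_mul i _ hf.differentiable_of_top]
  ring

/-- **Test functions up to the boundary** (Proposition 4.1). Let `Ω` be a smooth bounded
open set and `w ∈ W_0^{1,1}(Ω)` be nonnegative, with distributional Laplacian equal to a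
finite signed Borel measure `ν` in `Ω`. Then for every nonnegative `ψ ∈ C^∞(Ω̄)`,
`∫_Ω ψ d(Δw) ≤ ∫_Ω w Δψ`. -/
theorem test_function_inequality
    (Ω : Set (EuclideanSpace ℝ (Fin N))) (hΩ : SmoothBoundedDomain Ω)
    (w : EuclideanSpace ℝ (Fin N) → ℝ) (hw : MemW011 Ω w)
    (hw0 : ∀ᵐ x ∂(volume.restrict Ω), 0 ≤ w x)
    (ν : SignedMeasure (EuclideanSpace ℝ (Fin N)))
    (hνΩ : ν.totalVariation Ωᶜ = 0)
    (hνlap : ∀ φ : EuclideanSpace ℝ (Fin N) → ℝ, IsTestFun Ω φ →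
      ∫ x in Ω, w x * lap φ x = signedIntegral ν φ)
    (ψ : EuclideanSpace ℝ (Fin N) → ℝ) (hψ : ContDiff ℝ (⊤ : ℕ∞) ψ)
    (hψ0 : ∀ x ∈ closure Ω, 0 ≤ ψ x) :
    signedIntegral ν ψ ≤ ∫ x in Ω, w x * lap ψ x := by
  obtain ⟨hΩo, hb, f, hf, hΩf, hfr, hgrad⟩ := hΩ
  obtain ⟨g, hg, hwg⟩ := hw.exists_weak_gradient hΩo hb
  have hwi := hw.1
  have hae : ∀ᵐ x ∂(volume.restrict Ω), x ∈ Ω := ae_restrict_mem hΩo.measurableSet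
  have hneg : ∀ x ∈ Ω, f x < 0 := fun x hx => by
    rw [hΩf] at hx
    exact hx
  have hint : ∀ {v : EuclideanSpace ℝ (Fin N) → ℝ}, Continuous v →
      Integrable (fun x => w x * v x) (volume.restrict Ω) := fun hv => by
    obtain ⟨M, -, hM⟩ := exists_bound_of_isBounded hb hv
    exact integrable_mul_of_bounded_on hae hwi hv hM
  have hf' := fun i => contDiff_partialD i hf
  have hψ' := fun i => contDiff_partialD i hψ
  have he : ∀ k : ℕ, ContDiff ℝ (⊤ : ℕ∞) fun x => Real.exp (k * f x) := fun k =>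
    contDiff_exp_mul k hf
  have hGc : Continuous fun x => ∑ i, partialD i f x ^ 2 :=
    continuous_finsetSum _ fun i _ => (hf' i).continuous.pow 2
  obtain ⟨c, hc0, hc⟩ : ∃ c > 0, ∀ x ∈ Ω, c ≤ (∑ i, partialD i f x ^ 2) + -f x := by
    rcases (closure Ω).eq_empty_or_nonempty with h | h
    · exact ⟨1, one_pos, fun x hx => absurd (subset_closure hx) (by simp [h])⟩
    · obtain ⟨y, hy, hmin⟩ := hb.isCompact_closure.exists_isMinOn h
        (hGc.add hf.continuous.neg).continuousOn
      refine ⟨_, ?_, fun x hx => hmin (subset_closure hx)⟩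
      by_cases hyΩ : y ∈ Ω
      · exact add_pos_of_nonneg_of_pos (Finset.sum_nonneg fun i _ => sq_nonneg _)
          (neg_pos.2 (hneg y hyΩ))
      · have hyf : y ∈ frontier Ω := by
          rw [hΩo.frontier_eq]
          exact ⟨hy, hyΩ⟩
        have hy0 : f y = 0 := by
          rw [hfr] at hyf
          exact hyf
        simpa [hy0] using sum_partialD_sq_pos (hgrad y hyf)
  have hBc : Continuous fun x => 2 * ∑ i, partialD i ψ x * partialD i f x + ψ x * lap f x :=
    (continuous_const.mul (continuous_finsetSum _ fun i _ =>
      (hψ' i).continuous.mul (hf' i).continuous)).add (hψ.continuous.mul (continuous_lap hf))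
  obtain ⟨A, hA0, hA⟩ := exists_bound_of_isBounded hb (continuous_lap hψ)
  obtain ⟨B, hB0, hB⟩ := exists_bound_of_isBounded hb hBc
  obtain ⟨P, hP0, hP⟩ := exists_bound_of_isBounded hb hψ.continuous
  have hF : ∀ k : ℕ, ContDiff ℝ (⊤ : ℕ∞) fun x => ψ x - ψ x * Real.exp (k * f x) := fun k =>
    hψ.sub (hψ.mul (he k))
  have hFeq : ∀ (k : ℕ) x, ψ x - ψ x * Real.exp (k * f x) = ψ x * (1 - Real.exp (k * f x)) :=
    fun k x => by ring
  have hid : ∀ k : ℕ, ∫ x in Ω, w x * lap (fun x => ψ x - ψ x * Real.exp (k * f x)) x =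
      signedIntegral ν fun x => ψ x - ψ x * Real.exp (k * f x) := fun k =>
    integral_mul_lap_eq_signedIntegral_of_abs_le hΩo hb hf hΩf hwi hg hwg hνΩ hνlap (hF k)
      (K := P * k) fun x hx => by
        rw [hFeq, abs_mul, mul_assoc]
        exact mul_le_mul (hP x hx) (abs_one_sub_exp_nat_mul_le (hneg x hx) k) (abs_nonneg _) hP0
  have hlhs : Tendsto (fun k : ℕ => signedIntegral ν fun x => ψ x - ψ x * Real.exp (k * f x))
      atTop (𝓝 (signedIntegral ν ψ)) := by
    refine tendsto_signedIntegral_of_bounded_on hνΩ (fun k => (hF k).continuous)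
      (M := P + P * 1) (fun k x hx => ?_) fun x hx => ?_
    · refine (abs_sub _ _).trans (add_le_add (hP x hx) ?_)
      rw [abs_mul]
      exact mul_le_mul (hP x hx) (exp_nat_mul_le_one (hneg x hx) k) (abs_nonneg _) hP0
    · simpa using ((tendsto_exp_nat_mul_of_neg (hneg x hx)).const_mul (ψ x)).const_sub (ψ x)
  have ht1 : Tendsto (fun k : ℕ => ∫ x in Ω, w x * Real.exp (k * f x)) atTop (𝓝 0) := by
    simpa using tendsto_integral_mul_of_bounded_on (v' := fun _ => 0) hae hwi
      (fun k => (he k).continuous) (fun k x hx => exp_nat_mul_le_one (hneg x hx) k)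
      (fun x hx => tendsto_exp_nat_mul_of_neg (hneg x hx))
  have ht2 := tendsto_integral_boundary_layer hΩo hb hf hneg hwi hg hwg
  have hc3 : ∀ k : ℕ, Continuous fun x => k * Real.exp (k * f x) * -f x := fun k =>
    (continuous_const.mul (he k).continuous).mul hf.continuous.neg
  have ht3 : Tendsto (fun k : ℕ => ∫ x in Ω, w x * (k * Real.exp (k * f x) * -f x)) atTop
      (𝓝 0) := by
    simpa only [mul_zero, integral_zero] using
      tendsto_integral_mul_of_bounded_on (v' := fun _ => 0) hae hwi hc3
      (fun k x hx => abs_nat_mul_exp_mul_neg_le_one (hneg x hx) k)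
      (fun x hx => tendsto_nat_mul_exp_mul_neg (hneg x hx))
  have hrhs := ((ht1.const_mul A).add ((ht2.add ht3).const_mul (B / c))).const_add
    (∫ x in Ω, w x * lap ψ x)
  rw [add_zero, mul_zero, mul_zero, add_zero, add_zero] at hrhs
  refine le_of_tendsto_of_tendsto' hlhs hrhs fun k => ?_
  have hc2 : Continuous fun x => k * Real.exp (k * f x) * ∑ i, partialD i f x ^ 2 :=
    (continuous_const.mul (he k).continuous).mul hGc
  have i1 := (hint (he k).continuous).const_mul A
  have i2 := ((hint hc2).add (hint (hc3 k))).const_mul (B / c)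
  rw [← hid k, ← integral_add (hint hc2) (hint (hc3 k)), ← integral_const_mul,
    ← integral_const_mul]
  erw [← integral_add i1 i2, ← integral_add (hint (continuous_lap hψ)) (i1.add i2)]
  refine integral_mono_ae (hint (continuous_lap (hF k)))
    ((hint (continuous_lap hψ)).add (i1.add i2)) ?_
  filter_upwards [hw0, hae] with x hwx hx
  have hlap : lap (fun x => ψ x - ψ x * Real.exp (k * f x)) x = lap ψ x -
      (Real.exp (k * f x) * lap ψ x +
        k * Real.exp (k * f x) * (2 * ∑ i, partialD i ψ x * partialD i f x + ψ x * lap f x) +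
        ψ x * (k ^ 2 * Real.exp (k * f x) * ∑ i, partialD i f x ^ 2)) := by
    rw [lap_sub hψ (hψ.mul (he k)), lap_mul hψ (he k), lap_exp_mul k hf]
    simp_rw [partialD_exp_mul _ _ hf.differentiable_of_top]
    have : ∑ i, partialD i ψ x * (Real.exp (k * f x) * (k * partialD i f x)) =
        k * Real.exp (k * f x) * ∑ i, partialD i ψ x * partialD i f x := by
      rw [Finset.mul_sum]
      exact Finset.sum_congr rfl fun i _ => by ring
    rw [this]
    ring
  have hG0 : 0 ≤ ∑ i, partialD i f x ^ 2 := Finset.sum_nonneg fun i _ => sq_nonneg _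
  have hE := Real.exp_pos (k * f x)
  have hk : (0 : ℝ) ≤ k := Nat.cast_nonneg k
  have e1 := mul_le_mul_of_nonneg_left (abs_le.1 (hA x hx)).1 hE.le
  have hB' : B ≤ B / c * ((∑ i, partialD i f x ^ 2) + -f x) := by
    rw [div_mul_eq_mul_div, le_div_iff₀ hc0]
    exact mul_le_mul_of_nonneg_left (hc x hx) hB0
  have e2 := mul_le_mul_of_nonneg_left
    ((neg_le_neg hB').trans (abs_le.1 (hB x hx)).1) (mul_nonneg hk hE.le)
  have e3 : 0 ≤ ψ x * (k ^ 2 * Real.exp (k * f x) * ∑ i, partialD i f x ^ 2) :=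
    mul_nonneg (hψ0 x (subset_closure hx)) (by positivity)
  have key : lap (fun x => ψ x - ψ x * Real.exp (k * f x)) x ≤ lap ψ x +
      (A * Real.exp (k * f x) + B / c * (k * Real.exp (k * f x) * ∑ i, partialD i f x ^ 2 +
        k * Real.exp (k * f x) * -f x)) := by
    rw [hlap]
    linarith
  refine (mul_le_mul_of_nonneg_left key hwx).trans (le_of_eq ?_)
  simp only [Pi.add_apply]
  ring
end
end

section
/- Let Ω ⊂ ℝ^N be a smooth bounded open set, let V ∈ L^1(Ω) be nonnegative, and let f be a measurable function on Ω with 0 ≤ f ≤ 1 almost everywhere. If v solves the Dirichlet problem −Δv + Vv = f in Ω, v = 0 on ∂Ω, in the sense of Littman–Stampacchia–Weinberger, and ζ solves −Δζ = 1 in Ω, ζ = 0 on ∂Ω, then v ≤ ζ almost everywhere in Ω. -/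
open MeasureTheory Filter Metric
open scoped ENNReal Topology

noncomputable section

variable {N : ℕ}

/-- `v` solves the Dirichlet problem `-Δv + Vv = f dx` in `Ω`, `v = 0` on `∂Ω`, in the
sense of Littman–Stampacchia–Weinberger. -/
def IsLSWSolFun (Ω : Set (EuclideanSpace ℝ (Fin N))) (V : EuclideanSpace ℝ (Fin N) → ℝ)
    (f : EuclideanSpace ℝ (Fin N) → ℝ) (v : EuclideanSpace ℝ (Fin N) → ℝ) : Prop :=
  Integrable v (volume.restrict Ω) ∧
  Integrable (fun x => V x * v x) (volume.restrict Ω) ∧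
  ∀ ζ : EuclideanSpace ℝ (Fin N) → ℝ, ContDiff ℝ (⊤ : ℕ∞) ζ → (∀ x ∈ frontier Ω, ζ x = 0) →
    ∫ x in Ω, v x * (-(lap ζ x) + V x * ζ x) = ∫ x in Ω, ζ x * f x

local notation "𝔼" => EuclideanSpace ℝ (Fin N)

/-- The squared norm of the gradient, as the sum of the squared partial derivatives. -/
def gradSq (φ : 𝔼 → ℝ) (x : 𝔼) : ℝ :=
  ∑ i : Fin N, (fderiv ℝ φ x (EuclideanSpace.single i 1)) ^ 2

lemma lap_eq_sum_fderiv (φ : 𝔼 → ℝ) (x : 𝔼) :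
    lap φ x = ∑ i : Fin N, fderiv ℝ (fderiv ℝ φ) x (EuclideanSpace.single i 1)
      (EuclideanSpace.single i 1) := by
  simp [lap, iteratedFDeriv_two_apply]

lemma gradSq_nonneg (φ : 𝔼 → ℝ) (x : 𝔼) : 0 ≤ gradSq φ x :=
  Finset.sum_nonneg fun _ _ => sq_nonneg _

lemma continuous_lap_s17 {φ : 𝔼 → ℝ} (hφ : ContDiff ℝ 2 φ) : Continuous (lap φ) := by
  have h1 : ContDiff ℝ 1 (fderiv ℝ φ) := hφ.fderiv_right (by norm_num)
  have h2 : Continuous (fderiv ℝ (fderiv ℝ φ)) := h1.continuous_fderiv (by norm_num)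
  rw [funext (lap_eq_sum_fderiv φ)]
  fun_prop

lemma lap_congr_of_eventuallyEq {φ ψ : 𝔼 → ℝ} {x : 𝔼} (h : φ =ᶠ[𝓝 x] ψ) :
    lap φ x = lap ψ x := by
  rw [lap_eq_sum_fderiv, lap_eq_sum_fderiv, h.fderiv.fderiv_eq]

lemma fderiv_comp_real {g : ℝ → ℝ} {u : 𝔼 → ℝ} (hg : Differentiable ℝ g)
    (hu : Differentiable ℝ u) :
    fderiv ℝ (fun y => g (u y)) = fun y => deriv g (u y) • fderiv ℝ u y := by
  ext1 y
  exact ((hg (u y)).hasDerivAt.comp_hasFDerivAt y (hu y).hasFDerivAt).fderiv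

lemma lap_comp_real {g : ℝ → ℝ} {u : 𝔼 → ℝ} (hg : ContDiff ℝ 2 g) (hu : ContDiff ℝ 2 u) (x : 𝔼) :
    lap (fun y => g (u y)) x
      = deriv (deriv g) (u x) * gradSq u x + deriv g (u x) * lap u x := by
  have hg1 : ContDiff ℝ 1 (deriv g) := by
    have : ContDiff ℝ (1 + 1) g := by simpa [one_add_one_eq_two] using hg
    exact (contDiff_succ_iff_deriv.1 this).2.2
  have hu1 : ContDiff ℝ 1 (fderiv ℝ u) := hu.fderiv_right (by norm_num)
  have hgd : Differentiable ℝ g := hg.differentiable (by norm_num)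
  have hud : Differentiable ℝ u := hu.differentiable (by norm_num)
  have hg1d : Differentiable ℝ (deriv g) := hg1.differentiable (by norm_num)
  have hu1d : Differentiable ℝ (fderiv ℝ u) := hu1.differentiable (by norm_num)
  have h := ((hg1d (u x)).hasDerivAt.comp_hasFDerivAt x (hud x).hasFDerivAt).smul
    (hu1d x).hasFDerivAt
  rw [lap_eq_sum_fderiv, lap_eq_sum_fderiv, fderiv_comp_real hgd hud, gradSq, Finset.mul_sum,
    Finset.mul_sum, ← Finset.sum_add_distrib]
  refine Finset.sum_congr rfl fun i _ => ?_
  have h' := h.fderiv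
  simp only [Function.comp_def] at h'
  change (fderiv ℝ (fun y => deriv g (u y) • fderiv ℝ u y) x) _ _ = _
  erw [h']
  simp
  ring

lemma lap_add {φ ψ : 𝔼 → ℝ} (hφ : ContDiff ℝ 2 φ) (hψ : ContDiff ℝ 2 ψ) (x : 𝔼) :
    lap (fun y => φ y + ψ y) x = lap φ x + lap ψ x := by
  have h := iteratedFDeriv_add_apply (x := x) hφ.contDiffAt hψ.contDiffAt
  simp only [lap, ← Finset.sum_add_distrib]
  refine Finset.sum_congr rfl fun i _ => ?_
  change iteratedFDeriv ℝ 2 (φ + ψ) x _ = _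
  rw [h]; rfl

lemma lap_const_mul {φ : 𝔼 → ℝ} (hφ : ContDiff ℝ 2 φ) (c : ℝ) (x : 𝔼) :
    lap (fun y => c * φ y) x = c * lap φ x := by
  have h := iteratedFDeriv_const_smul_apply (i := 2) (x := x) (a := c) hφ.contDiffAt
  simp only [lap, Finset.mul_sum]
  refine Finset.sum_congr rfl fun i _ => ?_
  change iteratedFDeriv ℝ 2 (c • φ) x _ = _
  rw [h]; rfl

lemma lap_sub_s17 {φ ψ : 𝔼 → ℝ} (hφ : ContDiff ℝ 2 φ) (hψ : ContDiff ℝ 2 ψ) (x : 𝔼) :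
    lap (fun y => φ y - ψ y) x = lap φ x - lap ψ x := by
  have h := lap_add hφ (contDiff_const.mul hψ : ContDiff ℝ 2 fun y => (-1 : ℝ) * ψ y) x
  rw [lap_const_mul hψ] at h
  simpa [sub_eq_add_neg] using h

/-- The squared distance to `y`, perturbed by a term that vanishes on the zero set of `d`. -/
def reflDist (c : ℝ) (d : 𝔼 → ℝ) (y x : 𝔼) : ℝ := ‖x - y‖ ^ 2 + c * d y * d x

lemma reflDist_comm (c : ℝ) (d : 𝔼 → ℝ) (y x : 𝔼) : reflDist c d y x = reflDist c d x y := by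
  rw [reflDist, reflDist, norm_sub_rev]; ring

lemma contDiff_reflDist (c : ℝ) {d : 𝔼 → ℝ} {n : WithTop ℕ∞} (hd : ContDiff ℝ n d) :
    ContDiff ℝ n fun p : 𝔼 × 𝔼 => reflDist c d p.2 p.1 := by
  unfold reflDist
  have h1 : ContDiff ℝ n fun p : 𝔼 × 𝔼 => ‖p.1 - p.2‖ ^ 2 :=
    (contDiff_fst.sub contDiff_snd).norm_sq ℝ
  have h2 := hd.comp (contDiff_fst (E := 𝔼) (F := 𝔼))
  have h3 := hd.comp (contDiff_snd (E := 𝔼) (F := 𝔼))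
  exact h1.add ((contDiff_const.mul h3).mul h2)

lemma fderiv_reflDist (c : ℝ) {d : 𝔼 → ℝ} (hd : Differentiable ℝ d) (y : 𝔼) :
    fderiv ℝ (reflDist c d y) =
      fun x => (2 : ℝ) • innerSL ℝ (x - y) + (c * d y) • fderiv ℝ d x := by
  ext1 x
  have h1 : HasFDerivAt (fun x : 𝔼 => ‖x - y‖ ^ 2) ((2 : ℝ) • innerSL ℝ (x - y)) x := by
    have h := ((hasFDerivAt_id x).sub_const y).norm_sq
    rw [ContinuousLinearMap.comp_id, ← Nat.cast_smul_eq_nsmul ℝ] at h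
    exact_mod_cast h
  exact (h1.add ((hd x).hasFDerivAt.const_mul (c * d y))).fderiv

lemma sum_fderiv_mul_coord (L : 𝔼 →L[ℝ] ℝ) (z : 𝔼) :
    ∑ i, z i * L (EuclideanSpace.single i 1) = L z := by
  conv_rhs => rw [← (EuclideanSpace.basisFun (Fin N) ℝ).sum_repr z]
  simp [map_sum]

lemma gradSq_reflDist (c : ℝ) {d : 𝔼 → ℝ} (hd : Differentiable ℝ d) (y x : 𝔼) :
    gradSq (reflDist c d y) x = 4 * ‖x - y‖ ^ 2 + 4 * (c * d y) * fderiv ℝ d x (x - y)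
      + (c * d y) ^ 2 * gradSq d x := by
  rw [gradSq, fderiv_reflDist c hd, ← sum_fderiv_mul_coord, EuclideanSpace.norm_sq_eq, gradSq,
    Finset.mul_sum, Finset.mul_sum, Finset.mul_sum, ← Finset.sum_add_distrib,
    ← Finset.sum_add_distrib]
  refine Finset.sum_congr rfl fun i _ => ?_
  simp [EuclideanSpace.inner_single_right]
  ring

lemma lap_reflDist (c : ℝ) {d : 𝔼 → ℝ} (hd : ContDiff ℝ 2 d) (y x : 𝔼) :
    lap (reflDist c d y) x = 2 * N + c * d y * lap d x := by
  have hd1 : ContDiff ℝ 1 (fderiv ℝ d) := hd.fderiv_right (by norm_num)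
  have hd1d : Differentiable ℝ (fderiv ℝ d) := hd1.differentiable (by norm_num)
  rw [lap_eq_sum_fderiv, fderiv_reflDist c (hd.differentiable (by norm_num)), lap_eq_sum_fderiv]
  have h1 : HasFDerivAt (fun x : 𝔼 => (2 : ℝ) • innerSL ℝ (x - y)) ((2 : ℝ) • innerSL ℝ) x :=
    (((innerSL ℝ).hasFDerivAt (x := x - y)).comp x ((hasFDerivAt_id x).sub_const y)).const_smul
      (2 : ℝ)
  have h2 := (h1.add ((hd1d x).hasFDerivAt.const_smul (c * d y))).fderiv
  have h3 : (fun x => (2 : ℝ) • innerSL ℝ (x - y) + (c * d y) • fderiv ℝ d x)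
     = (fun x : 𝔼 => (2 : ℝ) • innerSL ℝ (x - y)) + (c * d y) • fderiv ℝ d := rfl
  have h4 : ∀ i : Fin N, ((2 : ℝ) • innerSL ℝ : 𝔼 →L[ℝ] 𝔼 →L[ℝ] ℝ) (EuclideanSpace.single i 1)
      (EuclideanSpace.single i 1) = 2 := by
    intro i
    change (2 : ℝ) * inner ℝ (EuclideanSpace.single i (1 : ℝ)) (EuclideanSpace.single i (1 : ℝ)) = 2
    simp
  rw [h3, h2]
  simp only [add_apply, h4, Finset.sum_add_distrib, Finset.mul_sum]
  simp [mul_comm]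

lemma integral_mul_lap_comm {u φ : 𝔼 → ℝ} (hu : ContDiff ℝ 2 u) (hφ : ContDiff ℝ 2 φ)
    (hc : HasCompactSupport u) : ∫ x, u x * lap φ x = ∫ x, lap u x * φ x := by
  have hu1 : ContDiff ℝ 1 (fderiv ℝ u) := hu.fderiv_right (by norm_num)
  have hφ1 : ContDiff ℝ 1 (fderiv ℝ φ) := hφ.fderiv_right (by norm_num)
  have hu2 : Continuous (fderiv ℝ (fderiv ℝ u)) := hu1.continuous_fderiv (by norm_num)
  have hφ2 : Continuous (fderiv ℝ (fderiv ℝ φ)) := hφ1.continuous_fderiv (by norm_num)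
  have cu := hu.continuous
  have cφ := hφ.continuous
  have cu1 := hu1.continuous
  have cφ1 := hφ1.continuous
  have du := hu.differentiable (by norm_num)
  have dφ := hφ.differentiable (by norm_num)
  have du1 := hu1.differentiable (by norm_num)
  have dφ1 := hφ1.differentiable (by norm_num)
  have hc1 : HasCompactSupport (fderiv ℝ u) := hc.fderiv ℝ
  have hc2 : HasCompactSupport (fderiv ℝ (fderiv ℝ u)) := hc1.fderiv ℝ
  have key : ∀ v : 𝔼, Integrable (fun x => u x * fderiv ℝ (fderiv ℝ φ) x v v) ∧
      Integrable (fun x => fderiv ℝ (fderiv ℝ u) x v v * φ x) ∧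
      ∫ x, u x * fderiv ℝ (fderiv ℝ φ) x v v = ∫ x, fderiv ℝ (fderiv ℝ u) x v v * φ x := by
    intro v
    have e1 : ∀ x, fderiv ℝ (fun y => fderiv ℝ φ y v) x v = fderiv ℝ (fderiv ℝ φ) x v v := by
      intro x
      rw [fderiv_clm_apply (dφ1 x) (differentiableAt_const v)]; simp
    have e2 : ∀ x, fderiv ℝ (fun y => fderiv ℝ u y v) x v = fderiv ℝ (fderiv ℝ u) x v v := by
      intro x
      rw [fderiv_clm_apply (du1 x) (differentiableAt_const v)]; simp
    have hcv : HasCompactSupport fun x => fderiv ℝ u x v :=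
      hc1.comp_left (g := fun L : 𝔼 →L[ℝ] ℝ => L v) (by simp)
    have hcvv : HasCompactSupport fun x => fderiv ℝ (fderiv ℝ u) x v v :=
      hc2.comp_left (g := fun L : 𝔼 →L[ℝ] 𝔼 →L[ℝ] ℝ => L v v) (by simp)
    have i1 : Integrable (fun x => u x * fderiv ℝ (fderiv ℝ φ) x v v) :=
      (by fun_prop : Continuous _).integrable_of_hasCompactSupport hc.mul_right
    have i2 : Integrable (fun x => fderiv ℝ (fderiv ℝ u) x v v * φ x) :=
      (by fun_prop : Continuous _).integrable_of_hasCompactSupport hcvv.mul_right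
    have i3 : Integrable (fun x => fderiv ℝ u x v * fderiv ℝ φ x v) :=
      (by fun_prop : Continuous _).integrable_of_hasCompactSupport hcv.mul_right
    have i4 : Integrable (fun x => u x * fderiv ℝ φ x v) :=
      (by fun_prop : Continuous _).integrable_of_hasCompactSupport hc.mul_right
    have i5 : Integrable (fun x => fderiv ℝ u x v * φ x) :=
      (by fun_prop : Continuous _).integrable_of_hasCompactSupport hcv.mul_right
    refine ⟨i1, i2, ?_⟩
    have a1 := integral_mul_fderiv_eq_neg_fderiv_mul_of_integrable (μ := volume) (f := u)
      (g := fun y => fderiv ℝ φ y v) (v := v) i3 (by simpa only [e1] using i1) i4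
      (fun x _ => du x) (fun x _ => (dφ1 x).clm_apply (differentiableAt_const v))
    have a2 := integral_mul_fderiv_eq_neg_fderiv_mul_of_integrable (μ := volume)
      (f := fun y => fderiv ℝ u y v)
      (g := φ) (v := v) (by simpa only [e2] using i2) i3 i5
      (fun x _ => (du1 x).clm_apply (differentiableAt_const v)) (fun x _ => dφ x)
    simp only [e1] at a1
    simp only [e2] at a2
    rw [a1, a2, neg_neg]
  simp only [lap_eq_sum_fderiv, Finset.mul_sum, Finset.sum_mul]
  rw [integral_finsetSum _ fun i _ => (key _).1, integral_finsetSum _ fun i _ => (key _).2.1]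
  exact Finset.sum_congr rfl fun i _ => (key _).2.2

section ParametricIntegral

variable {F : Type} [NormedAddCommGroup F]

lemma exists_forall_norm_le_of_continuous {Ω : Set 𝔼} (hb : Bornology.IsBounded Ω)
    {K : 𝔼 × 𝔼 → F} (hK : Continuous K) (x₀ : 𝔼) :
    ∃ C, ∀ x ∈ ball x₀ 1, ∀ y ∈ Ω, ‖K (x, y)‖ ≤ C := by
  have hc : IsCompact (closedBall x₀ 1 ×ˢ closure Ω) :=
    (isCompact_closedBall _ _).prod hb.isCompact_closure
  obtain ⟨C, hC⟩ := hc.exists_bound_of_continuousOn hK.continuousOn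
  exact ⟨C, fun x hx y hy => hC (x, y) ⟨ball_subset_closedBall hx, subset_closure hy⟩⟩

variable [NormedSpace ℝ F]

lemma continuous_integral_smul_kernel {Ω : Set 𝔼} (hm : MeasurableSet Ω)
    (hb : Bornology.IsBounded Ω)
    {h : 𝔼 → ℝ} (hh : Integrable h (volume.restrict Ω)) {K : 𝔼 × 𝔼 → F} (hK : Continuous K) :
    Continuous fun x => ∫ y in Ω, h y • K (x, y) := by
  rw [continuous_iff_continuousAt]
  intro x₀
  obtain ⟨C, hC⟩ := exists_forall_norm_le_of_continuous hb hK x₀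
  refine continuousAt_of_dominated (bound := fun y => ‖h y‖ * C) ?_ ?_ (hh.norm.mul_const C) ?_
  · exact Eventually.of_forall fun x =>
      hh.aestronglyMeasurable.smul (by fun_prop : Continuous fun y => K (x, y)).aestronglyMeasurable
  · filter_upwards [ball_mem_nhds x₀ one_pos] with x hx
    filter_upwards [ae_restrict_mem hm] with y hy
    rw [norm_smul]
    gcongr
    exact hC x hx y hy
  · exact Eventually.of_forall fun y => by fun_prop

/-- The partial derivative of a kernel in its first variable. -/
def fderivFst (K : 𝔼 × 𝔼 → F) (p : 𝔼 × 𝔼) : 𝔼 →L[ℝ] F :=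
  (fderiv ℝ K p).comp (ContinuousLinearMap.inl ℝ 𝔼 𝔼)

lemma hasFDerivAt_fderivFst {K : 𝔼 × 𝔼 → F} (hK : Differentiable ℝ K) (x y : 𝔼) :
    HasFDerivAt (fun x => K (x, y)) (fderivFst K (x, y)) x :=
  (hK (x, y)).hasFDerivAt.comp x (hasFDerivAt_prodMk_left x y)

lemma ContDiff.fderivFst {K : 𝔼 × 𝔼 → F} {m n : WithTop ℕ∞} (hK : ContDiff ℝ n K)
    (hmn : m + 1 ≤ n) : ContDiff ℝ m (fderivFst K) :=
  (hK.fderiv_right hmn).clm_comp contDiff_const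

lemma hasFDerivAt_integral_smul_kernel {Ω : Set 𝔼} (hm : MeasurableSet Ω)
    (hb : Bornology.IsBounded Ω)
    {h : 𝔼 → ℝ} (hh : Integrable h (volume.restrict Ω)) {K : 𝔼 × 𝔼 → F} (hK : ContDiff ℝ 1 K)
    (x₀ : 𝔼) :
    HasFDerivAt (fun x => ∫ y in Ω, h y • K (x, y)) (∫ y in Ω, h y • fderivFst K (x₀, y)) x₀ := by
  have hK' : Continuous (fderivFst K) := (hK.fderivFst (m := 0) (by norm_num)).continuous
  have hKc := hK.continuous
  obtain ⟨C, hC⟩ := exists_forall_norm_le_of_continuous hb hK' x₀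
  obtain ⟨C', hC'⟩ := exists_forall_norm_le_of_continuous hb hKc x₀
  refine hasFDerivAt_integral_of_dominated_of_fderiv_le (bound := fun y => ‖h y‖ * C)
    (F' := fun x y => h y • fderivFst K (x, y)) (ball_mem_nhds x₀ one_pos) ?_ ?_ ?_ ?_
    (hh.norm.mul_const C) ?_
  · exact Eventually.of_forall fun x =>
      hh.aestronglyMeasurable.smul (by fun_prop : Continuous fun y => K (x, y)).aestronglyMeasurable
  · refine (hh.norm.mul_const C').mono'
      (hh.aestronglyMeasurable.smul
        (by fun_prop : Continuous fun y => K (x₀, y)).aestronglyMeasurable) ?_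
    filter_upwards [ae_restrict_mem hm] with y hy
    rw [norm_smul]
    gcongr
    exact hC' x₀ (mem_ball_self one_pos) y hy
  · exact hh.aestronglyMeasurable.smul
      (by fun_prop : Continuous fun y => fderivFst K (x₀, y)).aestronglyMeasurable
  · filter_upwards [ae_restrict_mem hm] with y hy x hx
    rw [norm_smul]
    gcongr
    exact hC x hx y hy
  · exact Eventually.of_forall fun y x _ =>
      (hasFDerivAt_fderivFst (hK.differentiable (by norm_num)) x y).const_smul (h y)

end ParametricIntegral

lemma contDiff_two_integral_kernel {Ω : Set 𝔼} (hm : MeasurableSet Ω)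
    (hb : Bornology.IsBounded Ω)
    {h : 𝔼 → ℝ} (hh : Integrable h (volume.restrict Ω)) {K : 𝔼 × 𝔼 → ℝ} (hK : ContDiff ℝ 2 K) :
    ContDiff ℝ 2 (fun x => ∫ y in Ω, h y * K (x, y)) ∧
    ∀ x, lap (fun x => ∫ y in Ω, h y * K (x, y)) x
      = ∫ y in Ω, h y * lap (fun x => K (x, y)) x := by
  have hK1 : ContDiff ℝ 1 K := hK.of_le (by norm_num)
  have hK' : ContDiff ℝ 1 (fderivFst K) := hK.fderivFst (by norm_num)
  have hK'' : Continuous (fderivFst (fderivFst K)) :=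
    (hK'.fderivFst (m := 0) (by norm_num)).continuous
  have d1 := hasFDerivAt_integral_smul_kernel hm hb hh hK1
  have d2 := hasFDerivAt_integral_smul_kernel hm hb hh hK'
  simp only [smul_eq_mul] at d1
  have e1 : fderiv ℝ (fun x => ∫ y in Ω, h y * K (x, y))
      = fun x => ∫ y in Ω, h y • fderivFst K (x, y) := funext fun x => (d1 x).fderiv
  have e2 : fderiv ℝ (fun x => ∫ y in Ω, h y • fderivFst K (x, y))
      = fun x => ∫ y in Ω, h y • fderivFst (fderivFst K) (x, y) := funext fun x => (d2 x).fderiv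
  constructor
  · have : ContDiff ℝ (1 + 1) (fun x => ∫ y in Ω, h y * K (x, y)) := by
      rw [contDiff_succ_iff_fderiv]
      refine ⟨fun x => (d1 x).differentiableAt, by simp, ?_⟩
      rw [e1, contDiff_one_iff_fderiv, e2]
      exact ⟨fun x => (d2 x).differentiableAt, continuous_integral_smul_kernel hm hb hh hK''⟩
    simpa [one_add_one_eq_two] using this
  · intro x
    have hint : Integrable (fun y => h y • fderivFst (fderivFst K) (x, y)) (volume.restrict Ω) := by
      obtain ⟨C, hC⟩ := exists_forall_norm_le_of_continuous hb hK'' x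
      refine (hh.norm.mul_const C).mono' (hh.aestronglyMeasurable.smul
        (by fun_prop : Continuous fun y => fderivFst (fderivFst K) (x, y)).aestronglyMeasurable) ?_
      filter_upwards [ae_restrict_mem hm] with y hy
      rw [norm_smul]
      gcongr
      exact hC x (mem_ball_self one_pos) y hy
    have hlap : ∀ y, lap (fun x => K (x, y)) x = ∑ i : Fin N, fderivFst (fderivFst K) (x, y)
        (EuclideanSpace.single i 1) (EuclideanSpace.single i 1) := by
      intro y
      have a1 : fderiv ℝ (fun x => K (x, y)) = fun x => fderivFst K (x, y) :=
        funext fun x => (hasFDerivAt_fderivFst (hK1.differentiable (by norm_num)) x y).fderiv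
      rw [lap_eq_sum_fderiv, a1, (hasFDerivAt_fderivFst (hK'.differentiable (by norm_num)) x y).fderiv]
    have happ : ∀ v : 𝔼, Integrable (fun y => h y * fderivFst (fderivFst K) (x, y) v v)
          (volume.restrict Ω) ∧
        (∫ y in Ω, h y • fderivFst (fderivFst K) (x, y)) v v
          = ∫ y in Ω, h y * fderivFst (fderivFst K) (x, y) v v := by
      intro v
      have b1 := hint.apply_continuousLinearMap v
      refine ⟨by simpa using b1.apply_continuousLinearMap v, ?_⟩
      rw [ContinuousLinearMap.integral_apply hint, ContinuousLinearMap.integral_apply b1]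
      simp
    rw [lap_eq_sum_fderiv, e1, e2]
    simp only [hlap, Finset.mul_sum]
    rw [integral_finsetSum _ fun i _ => (happ _).1]
    exact Finset.sum_congr rfl fun i _ => (happ _).2

lemma two_le_infty : (2 : WithTop ℕ∞) ≤ ((⊤ : ℕ∞) : WithTop ℕ∞) := by
  change ((2 : ℕ∞) : WithTop ℕ∞) ≤ _
  exact WithTop.coe_le_coe.2 le_top

lemma eq_zero_of_gradSq_eq_zero {φ : 𝔼 → ℝ} {x : 𝔼} (h : gradSq φ x = 0) : fderiv ℝ φ x = 0 := by
  have h1 := (Finset.sum_eq_zero_iff_of_nonneg (fun i _ => sq_nonneg _)).1 h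
  ext z
  rw [← sum_fderiv_mul_coord]
  simp only [zero_apply]
  exact Finset.sum_eq_zero fun i hi => by rw [pow_eq_zero_iff (two_ne_zero)|>.1 (h1 i hi), mul_zero]

lemma contDiff_gradSq {φ : 𝔼 → ℝ} (hφ : ContDiff ℝ (⊤ : ℕ∞) φ) :
    ContDiff ℝ (⊤ : ℕ∞) (gradSq φ) := by
  have h1 : ContDiff ℝ (⊤ : ℕ∞) (fderiv ℝ φ) := hφ.fderiv_right (by simp)
  unfold gradSq
  exact ContDiff.sum fun i _ => (h1.clm_apply contDiff_const).pow 2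

/-- A smooth bounded open set has a defining function whose gradient has unit length on the
boundary. -/
lemma SmoothBoundedDomain.exists_normalized {Ω : Set 𝔼} (hΩ : SmoothBoundedDomain Ω) :
    ∃ d : 𝔼 → ℝ, ContDiff ℝ (⊤ : ℕ∞) d ∧ (∀ x ∈ Ω, 0 < d x) ∧ (∀ x ∈ frontier Ω, d x = 0) ∧
      ∃ C, 0 ≤ C ∧ ∀ x ∈ Ω, |gradSq d x - 1| ≤ C * d x := by
  obtain ⟨-, hb, f, hf, hΩf, hfr, hne⟩ := hΩ
  set H : 𝔼 → ℝ := fun x => gradSq f x + f x ^ 2 with hH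
  have hHpos : ∀ x, 0 < H x := by
    intro x
    by_contra! h
    have h1 := gradSq_nonneg f x
    have h2 := sq_nonneg (f x)
    have h3 : gradSq f x = 0 := by simp only [hH] at h; linarith
    have h4 : f x = 0 := by
      have : f x ^ 2 = 0 := by simp only [hH] at h; linarith
      simpa using this
    exact hne x (by rw [hfr]; exact h4) (eq_zero_of_gradSq_eq_zero h3)
  have hHs : ContDiff ℝ (⊤ : ℕ∞) H := (contDiff_gradSq hf).add (hf.pow 2)
  set a : 𝔼 → ℝ := fun x => (√(H x))⁻¹ with ha
  have hsq : ∀ x, 0 < √(H x) := fun x => Real.sqrt_pos.2 (hHpos x)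
  have has : ContDiff ℝ (⊤ : ℕ∞) a := (hHs.sqrt fun x => (hHpos x).ne').inv fun x => (hsq x).ne'
  have hapos : ∀ x, 0 < a x := fun x => inv_pos.2 (hsq x)
  have ha2 : ∀ x, a x ^ 2 * (gradSq f x + f x ^ 2) = 1 := by
    intro x
    have : a x ^ 2 = (H x)⁻¹ := by simp only [ha]; rw [inv_pow, Real.sq_sqrt (hHpos x).le]
    rw [this]
    exact inv_mul_cancel₀ (hHpos x).ne'
  refine ⟨fun x => -(f x * a x), (hf.mul has).neg, ?_, ?_, ?_⟩
  · intro x hx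
    have : f x < 0 := by rw [hΩf] at hx; exact hx
    have := hapos x
    nlinarith
  · intro x hx
    rw [hfr] at hx
    have : f x = 0 := hx
    simp [this]
  · set X : 𝔼 → ℝ := fun x => ∑ i : Fin N, fderiv ℝ f x (EuclideanSpace.single i 1) *
      fderiv ℝ a x (EuclideanSpace.single i 1) with hX
    have hf1 : Continuous (fderiv ℝ f) := hf.continuous_fderiv (by simp)
    have ha1 : Continuous (fderiv ℝ a) := has.continuous_fderiv (by simp)
    have hXc : Continuous X := by simp only [hX]; fun_prop
    have hfd : Differentiable ℝ f := hf.differentiable (by simp)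
    have had : Differentiable ℝ a := has.differentiable (by simp)
    have hfc := hf.continuous
    have hac := has.continuous
    have hga : Continuous (gradSq a) := (contDiff_gradSq has).continuous
    have key : ∀ x, gradSq (fun x => -(f x * a x)) x - 1
        = f x * (-(a x ^ 2 * f x) + 2 * a x * X x + f x * gradSq a x) := by
      intro x
      have e1 : fderiv ℝ (fun x => -(f x * a x)) x = -(f x • fderiv ℝ a x + a x • fderiv ℝ f x) :=
        (((hfd x).hasFDerivAt.mul (had x).hasFDerivAt).neg).fderiv
      have e2 : gradSq (fun x => -(f x * a x)) x
          = a x ^ 2 * gradSq f x + 2 * a x * f x * X x + f x ^ 2 * gradSq a x := by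
        simp only [gradSq, e1, hX, Finset.mul_sum, ← Finset.sum_add_distrib]
        refine Finset.sum_congr rfl fun i _ => ?_
        simp
        ring
      rw [e2]
      linear_combination ha2 x
    have hcont : Continuous fun x => (a x)⁻¹ *
        (-(a x ^ 2 * f x) + 2 * a x * X x + f x * gradSq a x) :=
      (hac.inv₀ fun x => (hapos x).ne').mul (by fun_prop)
    obtain ⟨C, hC⟩ := hb.isCompact_closure.exists_bound_of_continuousOn hcont.continuousOn
    refine ⟨max C 0, le_max_right _ _, fun x hx => ?_⟩
    have hx' := hC x (subset_closure hx)
    have hfx : f x < 0 := by rw [hΩf] at hx; exact hx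
    have hd : 0 < -(f x * a x) := by have := hapos x; nlinarith
    have e : gradSq (fun x => -(f x * a x)) x - 1 = (f x * a x) * ((a x)⁻¹ *
        (-(a x ^ 2 * f x) + 2 * a x * X x + f x * gradSq a x)) := by
      rw [key]
      have := (hapos x).ne'
      field_simp
    rw [e, abs_mul, ← abs_neg (f x * a x), abs_of_pos hd, mul_comm]
    gcongr
    exact hx'.trans (le_max_left _ _)

lemma exists_abs_le_of_continuous {Ω : Set 𝔼} (hb : Bornology.IsBounded Ω) {φ : 𝔼 → ℝ}
    (hφ : Continuous φ) : ∃ C, 0 ≤ C ∧ ∀ x ∈ Ω, |φ x| ≤ C := by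
  obtain ⟨C, hC⟩ := hb.isCompact_closure.exists_bound_of_continuousOn hφ.continuousOn
  exact ⟨max C 0, le_max_right _ _, fun x hx => (hC x (subset_closure hx)).trans (le_max_left _ _)⟩

lemma lap_one_sub_exp {d : 𝔼 → ℝ} (hd : ContDiff ℝ 2 d) (l : ℝ) (x : 𝔼) :
    lap (fun y => 1 - Real.exp (-l * d y)) x
      = -(l * Real.exp (-l * d x) * (l * gradSq d x - lap d x)) := by
  have hg : ContDiff ℝ 2 fun s : ℝ => 1 - Real.exp (-l * s) := by fun_prop
  have h1 : ∀ s : ℝ, HasDerivAt (fun s : ℝ => Real.exp (-l * s)) (Real.exp (-l * s) * -l) s := by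
    intro s
    simpa using ((hasDerivAt_id s).const_mul (-l)).exp
  have e1 : deriv (fun s : ℝ => 1 - Real.exp (-l * s)) = fun s => l * Real.exp (-l * s) := by
    ext s
    rw [((h1 s).const_sub 1).deriv]; ring
  have e2 : ∀ s, deriv (fun s : ℝ => l * Real.exp (-l * s)) s = - l ^ 2 * Real.exp (-l * s) := by
    intro s
    rw [((h1 s).const_mul l).deriv]; ring
  rw [lap_comp_real hg hd x, e1, e2]
  ring

lemma lap_const_sub_norm_sq (a : ℝ) (x : 𝔼) : lap (fun y => a - ‖y‖ ^ 2) x = -(2 * N) := by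
  have e : (fun y : 𝔼 => ‖y‖ ^ 2) = reflDist 0 (fun _ => 0) 0 := by ext y; simp [reflDist]
  have h : ContDiff ℝ 2 fun y : 𝔼 => ‖y‖ ^ 2 := contDiff_id.norm_sq ℝ
  have h0 : lap (fun _ : 𝔼 => a) x = 0 := by simp [lap_eq_sum_fderiv]
  rw [lap_sub_s17 (φ := fun _ => a) contDiff_const h x, h0, e, lap_reflDist 0 contDiff_const]
  simp

/-- A smooth strictly superharmonic function on `Ω`, vanishing on the boundary, comparable from
above with the defining function `d`. -/
lemma exists_barrier (hN : 0 < N) {Ω : Set 𝔼} (hb : Bornology.IsBounded Ω)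
    {d : 𝔼 → ℝ} (hd : ContDiff ℝ (⊤ : ℕ∞) d) (hpos : ∀ x ∈ Ω, 0 < d x)
    (hfr : ∀ x ∈ frontier Ω, d x = 0) {C : ℝ} (hC0 : 0 ≤ C)
    (hC : ∀ x ∈ Ω, |gradSq d x - 1| ≤ C * d x) :
    ∃ φ : 𝔼 → ℝ, ContDiff ℝ (⊤ : ℕ∞) φ ∧ (∀ x ∈ frontier Ω, φ x = 0) ∧ (∀ x ∈ Ω, 0 ≤ φ x) ∧
      (∃ M, 0 ≤ M ∧ ∀ x ∈ Ω, φ x ≤ M * d x) ∧ ∃ c > 0, ∀ x ∈ Ω, c ≤ -lap φ x := by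
  have hd2 : ContDiff ℝ 2 d := hd.of_le two_le_infty
  obtain ⟨L, hL0, hL⟩ := exists_abs_le_of_continuous hb (continuous_lap_s17 hd2)
  obtain ⟨R, hR0, hR⟩ := exists_abs_le_of_continuous hb (continuous_norm (E := 𝔼))
  set d₀ : ℝ := 1 / (2 * (C + 1)) with hd₀
  have hd₀pos : 0 < d₀ := by positivity
  set θ : ℝ → ℝ := fun s => Real.smoothTransition (2 * s / d₀ - 1) with hθ
  set φ₂ : 𝔼 → ℝ := fun x => θ (d x) * (R ^ 2 - ‖x‖ ^ 2) with hφ₂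
  have hθs : ContDiff ℝ (⊤ : ℕ∞) θ := Real.smoothTransition.contDiff.comp
    (((contDiff_const.mul contDiff_id).div_const _).sub contDiff_const)
  have hφ₂s : ContDiff ℝ (⊤ : ℕ∞) φ₂ :=
    (hθs.comp hd).mul (contDiff_const.sub (contDiff_id.norm_sq ℝ))
  have hφ₂2 : ContDiff ℝ 2 φ₂ := hφ₂s.of_le two_le_infty
  obtain ⟨L₂, hL₂0, hL₂⟩ := exists_abs_le_of_continuous hb (continuous_lap_s17 hφ₂2)
  set K : ℝ := (L + 1) / 2 with hK
  set l : ℝ := 2 * (L + K * L₂ + 1) with hl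
  have hKpos : 0 < K := by positivity
  have hlpos : 0 < l := by positivity
  set b : ℝ := K * (l * Real.exp (-l * d₀)) with hb'
  have hbpos : 0 < b := by positivity
  have hφ₁s : ContDiff ℝ (⊤ : ℕ∞) fun y => 1 - Real.exp (-l * d y) :=
    contDiff_const.sub (contDiff_const.mul hd).exp
  have hθle : ∀ s, 0 < s → θ s ≤ 2 / d₀ * s := by
    intro s hs
    by_cases h : 2 * s / d₀ - 1 ≤ 0
    · rw [hθ]; simp only
      rw [Real.smoothTransition.zero_of_nonpos h]
      positivity
    · refine (Real.smoothTransition.le_one _).trans ?_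
      have : 2 / d₀ * s = 2 * s / d₀ := by ring
      rw [this]; linarith
  have hRx : ∀ x ∈ Ω, 0 ≤ R ^ 2 - ‖x‖ ^ 2 := by
    intro x hx
    have h1 := hR x hx
    rw [abs_of_nonneg (norm_nonneg _)] at h1
    have := norm_nonneg x
    nlinarith
  refine ⟨fun x => (1 - Real.exp (-l * d x)) + b * φ₂ x, hφ₁s.add (contDiff_const.mul hφ₂s),
    ?_, ?_, ⟨l + b * (2 / d₀ * R ^ 2), by positivity, ?_⟩, l * Real.exp (-l * d₀), by positivity, ?_⟩
  · intro x hx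
    have : Real.smoothTransition (-1) = 0 := Real.smoothTransition.zero_of_nonpos (by norm_num)
    simp [hφ₂, hθ, hfr x hx, this]
  · intro x hx
    have h1 : Real.exp (-l * d x) ≤ 1 := by
      rw [Real.exp_le_one_iff]; have := hpos x hx; nlinarith
    have h2 : 0 ≤ φ₂ x := mul_nonneg (Real.smoothTransition.nonneg _) (hRx x hx)
    have := mul_nonneg hbpos.le h2
    linarith
  · intro x hx
    have h1 := Real.add_one_le_exp (-l * d x)
    have h2 : φ₂ x ≤ (2 / d₀ * d x) * R ^ 2 := by
      have := sq_nonneg ‖x‖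
      exact mul_le_mul (hθle _ (hpos x hx)) (by linarith) (hRx x hx)
        (by have := hpos x hx; positivity)
    have := mul_le_mul_of_nonneg_left h2 hbpos.le
    linarith
  · intro x hx
    rw [lap_add (hφ₁s.of_le two_le_infty) (contDiff_const.mul hφ₂2),
      lap_const_mul hφ₂2, lap_one_sub_exp hd2]
    have hLx := abs_le.1 (hL x hx)
    have hL₂x := abs_le.1 (hL₂ x hx)
    have hCx := abs_le.1 (hC x hx)
    have hg := gradSq_nonneg d x
    by_cases h : d x ≤ d₀
    · have h1 : C * d x ≤ 1 / 2 := by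
        have : C * d x ≤ C * d₀ := by gcongr
        have h3 : C * d₀ ≤ 1 / 2 := by
          rw [hd₀, mul_one_div, div_le_div_iff₀ (by positivity) (by norm_num)]; linarith
        linarith
      have h2 : 1 / 2 ≤ gradSq d x := by linarith
      have h3 : Real.exp (-l * d₀) ≤ Real.exp (-l * d x) := by
        have := mul_le_mul_of_nonneg_left h hlpos.le
        exact Real.exp_le_exp.2 (by linarith)
      have h4 : K * L₂ + 1 ≤ l * gradSq d x - lap d x := by nlinarith
      have h5 : l * Real.exp (-l * d₀) * (K * L₂ + 1)
          ≤ l * Real.exp (-l * d x) * (l * gradSq d x - lap d x) := by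
        gcongr
      have h6 : b * lap φ₂ x ≤ b * L₂ := by gcongr; exact hL₂x.2
      have h7 : b * L₂ = l * Real.exp (-l * d₀) * (K * L₂) := by rw [hb']; ring
      linarith
    · push Not at h
      have e : lap φ₂ x = -(2 * N) := by
        have h0 : φ₂ =ᶠ[𝓝 x] fun y => R ^ 2 - ‖y‖ ^ 2 := by
          filter_upwards [hd.continuous.continuousAt.eventually (lt_mem_nhds h)] with y hy
          have : 1 ≤ 2 * d y / d₀ - 1 := by
            have : 1 ≤ d y / d₀ := by rw [one_le_div hd₀pos]; exact hy.le
            have e : 2 * d y / d₀ = 2 * (d y / d₀) := by ring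
            linarith
          simp [hφ₂, hθ, Real.smoothTransition.one_of_one_le this]
        rw [lap_congr_of_eventuallyEq h0, lap_const_sub_norm_sq]
      have h3 : Real.exp (-l * d x) ≤ Real.exp (-l * d₀) := by
        have := mul_le_mul_of_nonneg_left h.le hlpos.le
        exact Real.exp_le_exp.2 (by linarith)
      have hN1 : (1 : ℝ) ≤ N := by exact_mod_cast hN
      rw [e]
      have h4 : -L ≤ l * gradSq d x - lap d x := by
        have := mul_nonneg hlpos.le hg
        linarith
      have h5 : l * Real.exp (-l * d x) * (-L)
          ≤ l * Real.exp (-l * d x) * (l * gradSq d x - lap d x) := by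
        gcongr
      have h6 : l * Real.exp (-l * d x) * L ≤ l * Real.exp (-l * d₀) * L := by gcongr
      have h7 : b * 2 ≤ b * (2 * N) := by gcongr; linarith
      have h8 : b * 2 = l * Real.exp (-l * d₀) * (L + 1) := by rw [hb', hK]; ring
      linarith

/-- A smooth nonincreasing cutoff, equal to `1` on `(-∞, 0]` and to `0` on `[1, ∞)`. -/
def cutoff (s : ℝ) : ℝ := Real.smoothTransition (1 - s)

lemma contDiff_cutoff : ContDiff ℝ (⊤ : ℕ∞) cutoff :=
  Real.smoothTransition.contDiff.comp (contDiff_const.sub contDiff_id)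

lemma cutoff_nonneg (s : ℝ) : 0 ≤ cutoff s := Real.smoothTransition.nonneg _

lemma cutoff_of_one_le {s : ℝ} (hs : 1 ≤ s) : cutoff s = 0 :=
  Real.smoothTransition.zero_of_nonpos (by linarith)

lemma cutoff_zero : cutoff 0 = 1 := Real.smoothTransition.one_of_one_le (by norm_num)

lemma deriv_cutoff_of_one_lt {s : ℝ} (hs : 1 < s) : deriv cutoff s = 0 := by
  have : cutoff =ᶠ[𝓝 s] fun _ => 0 := by
    filter_upwards [lt_mem_nhds hs] with t ht using cutoff_of_one_le ht.le
  rw [this.deriv_eq]; simp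

lemma deriv_deriv_cutoff_of_one_lt {s : ℝ} (hs : 1 < s) : deriv (deriv cutoff) s = 0 := by
  have : deriv cutoff =ᶠ[𝓝 s] fun _ => 0 := by
    filter_upwards [lt_mem_nhds hs] with t ht using deriv_cutoff_of_one_lt ht
  rw [this.deriv_eq]; simp

lemma exists_cutoff_bound : ∃ M, 0 ≤ M ∧ ∀ s, 0 ≤ s →
    |cutoff s| ≤ M ∧ |deriv cutoff s| ≤ M ∧ |deriv (deriv cutoff) s| ≤ M := by
  have h1 : ContDiff ℝ (⊤ : ℕ∞) (deriv cutoff) := (contDiff_infty_iff_deriv.1 contDiff_cutoff).2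
  have h2 : ContDiff ℝ (⊤ : ℕ∞) (deriv (deriv cutoff)) := (contDiff_infty_iff_deriv.1 h1).2
  have hb : ∀ {g : ℝ → ℝ}, Continuous g → (∀ s, 1 < s → g s = 0) →
      ∃ M, 0 ≤ M ∧ ∀ s, 0 ≤ s → |g s| ≤ M := by
    intro g hg h0
    obtain ⟨C, hC⟩ := (isCompact_Icc (a := (0 : ℝ)) (b := 1)).exists_bound_of_continuousOn
      hg.continuousOn
    refine ⟨max C 0, le_max_right _ _, fun s hs => ?_⟩
    rcases le_or_gt s 1 with h | h
    · exact (hC s ⟨hs, h⟩).trans (le_max_left _ _)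
    · simp [h0 s h]
  obtain ⟨M₀, hM₀, h₀⟩ := hb contDiff_cutoff.continuous fun s hs => cutoff_of_one_le hs.le
  obtain ⟨M₁, hM₁, h₁⟩ := hb h1.continuous fun s hs => deriv_cutoff_of_one_lt hs
  obtain ⟨M₂, hM₂, h₂⟩ := hb h2.continuous fun s hs => deriv_deriv_cutoff_of_one_lt hs
  refine ⟨M₀ + M₁ + M₂, by positivity, fun s hs => ⟨?_, ?_, ?_⟩⟩
  · linarith [h₀ s hs]
  · linarith [h₁ s hs]
  · linarith [h₂ s hs]

variable (N) in
/-- The mass of the unnormalised mollifier at scale `ε`. -/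
def mollMass (ε : ℝ) : ℝ := ∫ z : 𝔼, cutoff (‖z‖ ^ 2 / ε ^ 2)

/-- The mollifier at scale `ε`, of integral one. -/
def moll (ε : ℝ) (z : 𝔼) : ℝ := (mollMass N ε)⁻¹ * cutoff (‖z‖ ^ 2 / ε ^ 2)

lemma continuous_cutoff_norm_sq (ε : ℝ) : Continuous fun z : 𝔼 => cutoff (‖z‖ ^ 2 / ε ^ 2) :=
  contDiff_cutoff.continuous.comp (by fun_prop)

lemma hasCompactSupport_cutoff_norm_sq {ε : ℝ} (hε : 0 < ε) :
    HasCompactSupport fun z : 𝔼 => cutoff (‖z‖ ^ 2 / ε ^ 2) := by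
  refine HasCompactSupport.intro (isCompact_closedBall (0 : 𝔼) ε) fun z hz => ?_
  rw [mem_closedBall_zero_iff, not_le] at hz
  refine cutoff_of_one_le ?_
  rw [one_le_div (by positivity)]
  gcongr

lemma mollMass_pos {ε : ℝ} (hε : 0 < ε) : 0 < mollMass N ε := by
  refine (continuous_cutoff_norm_sq ε).integral_pos_of_hasCompactSupport_nonneg_nonzero
    (x := (0 : 𝔼)) (hasCompactSupport_cutoff_norm_sq hε) (fun z => cutoff_nonneg _) ?_
  simp [cutoff_zero]

lemma mollMass_eq {ε : ℝ} (hε : 0 < ε) : mollMass N ε = ε ^ N * mollMass N 1 := by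
  have h := Measure.integral_comp_inv_smul (volume : Measure 𝔼)
    (fun z => cutoff (‖z‖ ^ 2 / 1 ^ 2)) ε
  simp only [finrank_euclideanSpace, Fintype.card_fin, smul_eq_mul] at h
  rw [abs_of_pos (by positivity)] at h
  rw [mollMass, mollMass, ← h]
  congr 1
  ext z
  rw [norm_smul, norm_inv, Real.norm_of_nonneg hε.le]
  congr 1
  field_simp

lemma moll_nonneg {ε : ℝ} (hε : 0 < ε) (z : 𝔼) : 0 ≤ moll ε z :=
  mul_nonneg (inv_nonneg.2 (mollMass_pos hε).le) (cutoff_nonneg _)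

lemma continuous_moll (ε : ℝ) : Continuous (moll ε : 𝔼 → ℝ) :=
  continuous_const.mul (continuous_cutoff_norm_sq ε)

lemma moll_eq_zero {ε : ℝ} (hε : 0 < ε) {z : 𝔼} (hz : ε ≤ ‖z‖) : moll ε z = 0 := by
  rw [moll, cutoff_of_one_le, mul_zero]
  rw [one_le_div (by positivity)]
  gcongr

lemma integrable_moll {ε : ℝ} (hε : 0 < ε) : Integrable (moll ε : 𝔼 → ℝ) :=
  (continuous_moll ε).integrable_of_hasCompactSupport
    (hasCompactSupport_cutoff_norm_sq hε).mul_left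

lemma integral_moll {ε : ℝ} (hε : 0 < ε) : ∫ z : 𝔼, moll ε z = 1 := by
  simp only [moll]
  rw [integral_const_mul]
  exact inv_mul_cancel₀ (mollMass_pos hε).ne'

lemma lintegral_enorm_moll_sub {ε : ℝ} (hε : 0 < ε) (y : 𝔼) :
    ∫⁻ x, ‖moll ε (x - y)‖ₑ = 1 := by
  have h1 : ∫⁻ x, ‖moll ε (x - y)‖ₑ = ∫⁻ x : 𝔼, ‖moll ε x‖ₑ :=
    lintegral_sub_right_eq_self (fun x => ‖moll ε x‖ₑ) y
  rw [h1, ← ofReal_integral_norm_eq_lintegral_enorm (integrable_moll hε)]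
  simp only [Real.norm_of_nonneg (moll_nonneg hε _)]
  rw [integral_moll hε, ENNReal.ofReal_one]

lemma lintegral_enorm_integral_moll_le {ε : ℝ} (hε : 0 < ε) {u : 𝔼 → ℝ} (hu : Integrable u) :
    ∫⁻ x, ‖∫ y, u y * moll ε (x - y)‖ₑ ≤ ∫⁻ y, ‖u y‖ₑ := by
  have hk : Continuous fun p : 𝔼 × 𝔼 => moll ε (p.1 - p.2) :=
    (continuous_moll ε).comp (continuous_fst.sub continuous_snd)
  calc ∫⁻ x, ‖∫ y, u y * moll ε (x - y)‖ₑ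
      ≤ ∫⁻ x, ∫⁻ y, ‖u y‖ₑ * ‖moll ε (x - y)‖ₑ := by
        gcongr with x
        refine (enorm_integral_le_lintegral_enorm _).trans_eq ?_
        simp only [enorm_mul]
    _ = ∫⁻ y, ∫⁻ x, ‖u y‖ₑ * ‖moll ε (x - y)‖ₑ :=
        lintegral_lintegral_swap
          ((hu.aestronglyMeasurable.comp_snd.enorm).mul hk.aestronglyMeasurable.enorm)
    _ = ∫⁻ y, ‖u y‖ₑ := by
        refine lintegral_congr fun y => ?_
        rw [lintegral_const_mul _ (by
          exact (hk.comp (continuous_id.prodMk continuous_const)).measurable.enorm),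
          lintegral_enorm_moll_sub hε, mul_one]

lemma integrable_mul_moll {ε : ℝ} {u : 𝔼 → ℝ} (hε : 0 < ε) (hu : Integrable u) (x : 𝔼) :
    Integrable fun y => u y * moll ε (x - y) := by
  have hc : Continuous fun y => moll ε (x - y) :=
    (continuous_moll ε).comp (continuous_const.sub continuous_id)
  obtain ⟨C, hC⟩ := (continuous_moll ε).bounded_above_of_compact_support
    (f := (moll ε : 𝔼 → ℝ)) (hasCompactSupport_cutoff_norm_sq hε).mul_left
  refine (hu.norm.mul_const C).mono' (hu.aestronglyMeasurable.mul hc.aestronglyMeasurable)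
    (Eventually.of_forall fun y => ?_)
  rw [norm_mul]
  gcongr
  exact hC _

lemma tendsto_lintegral_moll_sub_of_continuous {g : 𝔼 → ℝ} (hg : Continuous g)
    (hgc : HasCompactSupport g) :
    Tendsto (fun ε => ∫⁻ x, ‖(∫ y, g y * moll ε (x - y)) - g x‖ₑ) (𝓝[>] 0) (𝓝 0) := by
  have huc := hgc.uniformContinuous_of_continuous hg
  set V := volume (cthickening 1 (tsupport g)) with hV
  have hVfin : V ≠ ∞ := hgc.isCompact.cthickening.measure_lt_top.ne
  have hgi := hg.integrable_of_hasCompactSupport hgc (μ := volume)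
  have hmain : ∀ ω > 0, ∀ᶠ ε in 𝓝[>] (0 : ℝ),
      ∫⁻ x, ‖(∫ y, g y * moll ε (x - y)) - g x‖ₑ ≤ ENNReal.ofReal ω * V := by
    intro ω hω
    obtain ⟨δ, hδ, hδg⟩ := Metric.uniformContinuous_iff.1 huc ω hω
    filter_upwards [Ioo_mem_nhdsGT (lt_min hδ one_pos)] with ε hε
    have hε0 : 0 < ε := hε.1
    have hεδ : ε < δ := hε.2.trans_le (min_le_left _ _)
    have hε1 : ε < 1 := hε.2.trans_le (min_le_right _ _)
    have hmi : ∀ x : 𝔼, Integrable fun y => moll ε (x - y) := fun x =>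
      (integrable_moll hε0).comp_sub_left x
    have hm1 : ∀ x : 𝔼, ∫ y, moll ε (x - y) = 1 := fun x => by
      rw [integral_sub_left_eq_self (moll ε) volume x, integral_moll hε0]
    have hpt : ∀ x, ‖(∫ y, g y * moll ε (x - y)) - g x‖ₑ
        ≤ (cthickening 1 (tsupport g)).indicator (fun _ => ENNReal.ofReal ω) x := by
      intro x
      have e : (∫ y, g y * moll ε (x - y)) - g x = ∫ y, (g y - g x) * moll ε (x - y) := by
        simp only [sub_mul]
        rw [integral_sub (integrable_mul_moll hε0 hgi x) ((hmi x).const_mul _), integral_const_mul,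
          hm1, mul_one]
      by_cases hx : x ∈ cthickening 1 (tsupport g)
      · rw [Set.indicator_of_mem hx, e, ← ofReal_norm]
        apply ENNReal.ofReal_le_ofReal
        refine (norm_integral_le_of_norm_le ((hmi x).const_mul ω) (Eventually.of_forall fun y => ?_)
          ).trans_eq (by rw [integral_const_mul, hm1, mul_one])
        rw [norm_mul, Real.norm_of_nonneg (moll_nonneg hε0 _)]
        by_cases hxy : ε ≤ ‖x - y‖
        · simp [moll_eq_zero hε0 hxy]
        · refine mul_le_mul_of_nonneg_right ?_ (moll_nonneg hε0 _)
          push Not at hxy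
          rw [← dist_eq_norm]
          refine (hδg ?_).le
          rw [dist_comm, dist_eq_norm]
          exact hxy.trans hεδ
      · rw [Set.indicator_of_notMem hx]
        have h0 : ∀ y, g y * moll ε (x - y) = 0 := by
          intro y
          by_cases hy : y ∈ tsupport g
          · rw [moll_eq_zero hε0, mul_zero]
            by_contra! hlt
            exact hx (mem_cthickening_of_dist_le x y 1 _ hy
              (by rw [dist_eq_norm]; exact (hlt.trans hε1).le))
          · rw [image_eq_zero_of_notMem_tsupport hy, zero_mul]
        have hgx : g x = 0 := image_eq_zero_of_notMem_tsupport fun h =>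
          hx (self_subset_cthickening _ h)
        simp [h0, hgx]
    calc _ ≤ ∫⁻ x, (cthickening 1 (tsupport g)).indicator (fun _ => ENNReal.ofReal ω) x :=
          lintegral_mono hpt
      _ = _ := by rw [lintegral_indicator_const isClosed_cthickening.measurableSet]
  rw [ENNReal.tendsto_nhds_zero]
  intro η hη
  obtain ⟨ω, hω, hωη⟩ : ∃ ω : ℝ, 0 < ω ∧ ENNReal.ofReal ω * V ≤ η := by
    rcases eq_or_ne η ∞ with rfl | hη'
    · exact ⟨1, one_pos, le_top⟩
    · obtain ⟨r, hr, hr'⟩ := ENNReal.exists_nnreal_pos_mul_lt hVfin hη.ne'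
      exact ⟨r, hr, by simpa using hr'.le⟩
  filter_upwards [hmain ω hω] with ε h using h.trans hωη

lemma tendsto_lintegral_moll_sub {u : 𝔼 → ℝ} (hu : Integrable u) :
    Tendsto (fun ε => ∫⁻ x, ‖(∫ y, u y * moll ε (x - y)) - u x‖ₑ) (𝓝[>] 0) (𝓝 0) := by
  rw [ENNReal.tendsto_nhds_zero]
  intro η hη
  have hη3 : η / 3 ≠ 0 := (ENNReal.div_pos hη.ne' (by norm_num)).ne'
  obtain ⟨g, hgc, hgl, hg, hgi⟩ := hu.exists_hasCompactSupport_lintegral_sub_le hη3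
  have h3 := ENNReal.tendsto_nhds_zero.1 (tendsto_lintegral_moll_sub_of_continuous hg hgc) (η / 3)
    (pos_iff_ne_zero.2 hη3)
  filter_upwards [h3, self_mem_nhdsWithin] with ε hε hε0
  have hε0 : 0 < ε := hε0
  have hd : Integrable fun y => u y - g y := hu.sub hgi
  have hmeas : ∀ {w : 𝔼 → ℝ}, Integrable w →
      AEMeasurable (fun x => ‖∫ y, w y * moll ε (x - y)‖ₑ) := by
    intro w hw
    have hk : Continuous fun p : 𝔼 × 𝔼 => moll ε (p.1 - p.2) :=
      (continuous_moll ε).comp (continuous_fst.sub continuous_snd)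
    exact ((hw.aestronglyMeasurable.comp_snd.mul hk.aestronglyMeasurable).integral_prod_right').enorm
  calc ∫⁻ x, ‖(∫ y, u y * moll ε (x - y)) - u x‖ₑ
      ≤ ∫⁻ x, (‖∫ y, (u y - g y) * moll ε (x - y)‖ₑ
          + (‖u x - g x‖ₑ + ‖(∫ y, g y * moll ε (x - y)) - g x‖ₑ)) := by
        gcongr with x
        have e : (∫ y, u y * moll ε (x - y)) - u x = (∫ y, (u y - g y) * moll ε (x - y))
            + (-(u x - g x) + ((∫ y, g y * moll ε (x - y)) - g x)) := by
          simp only [sub_mul]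
          rw [integral_sub (integrable_mul_moll hε0 hu x) (integrable_mul_moll hε0 hgi x)]
          ring
        rw [e]
        refine (enorm_add_le _ _).trans ?_
        gcongr
        refine (enorm_add_le _ _).trans ?_
        rw [enorm_neg]
    _ = (∫⁻ x, ‖∫ y, (u y - g y) * moll ε (x - y)‖ₑ) + ((∫⁻ x, ‖u x - g x‖ₑ)
          + ∫⁻ x, ‖(∫ y, g y * moll ε (x - y)) - g x‖ₑ) := by
        rw [lintegral_add_left' (hmeas hd), lintegral_add_left' hd.aestronglyMeasurable.enorm]
    _ ≤ η / 3 + (η / 3 + η / 3) := by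
        gcongr
        exact (lintegral_enorm_integral_moll_le hε0 hd).trans hgl
    _ = η := by rw [← add_assoc, ENNReal.add_thirds]

lemma inv_mollMass_mul_volume_closedBall {ε : ℝ} (hε : 0 < ε) (y : 𝔼) :
    ENNReal.ofReal (mollMass N ε)⁻¹ * volume (closedBall y ε)
      = ENNReal.ofReal (mollMass N 1)⁻¹ * volume (closedBall (0 : 𝔼) 1) := by
  have h1 := mollMass_pos (N := N) one_pos
  rw [Measure.addHaar_closedBall' volume y hε.le, mollMass_eq hε, ← mul_assoc,
    ← ENNReal.ofReal_mul (by positivity)]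
  congr 2
  simp only [finrank_euclideanSpace, Fintype.card_fin]
  have : ε ^ N ≠ 0 := by positivity
  field_simp

/-- Kernels of mollifier size which only see points close to the zero set of `d` converge to zero
strongly in `L¹`. -/
lemma tendsto_lintegral_kernel_strip {Ω : Set 𝔼} (hm : MeasurableSet Ω) {d : 𝔼 → ℝ}
    (hd : Continuous d) (hpos : ∀ x ∈ Ω, 0 < d x) {h : 𝔼 → ℝ}
    (hh : Integrable h (volume.restrict Ω)) (r : ℝ → 𝔼 → 𝔼 → ℝ) {C a : ℝ}
    (hC : ∀ ε ∈ Set.Ioc (0 : ℝ) 1, ∀ x ∈ Ω, ∀ y ∈ Ω, |r ε x y| ≤ C * (mollMass N ε)⁻¹)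
    (hr : ∀ ε ∈ Set.Ioc (0 : ℝ) 1, ∀ x ∈ Ω, ∀ y ∈ Ω, r ε x y ≠ 0 → ‖x - y‖ ≤ ε ∧ d y ≤ a * ε) :
    Tendsto (fun ε => ∫⁻ x in Ω, ‖∫ y in Ω, h y * r ε x y‖ₑ) (𝓝[>] 0) (𝓝 0) := by
  set S : ℝ → Set 𝔼 := fun ε => {y | d y ≤ a * ε} with hS
  have hSm : ∀ ε, MeasurableSet (S ε) := fun ε => (isClosed_le hd continuous_const).measurableSet
  set D : ℝ≥0∞ := ENNReal.ofReal C *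
    (ENNReal.ofReal (mollMass N 1)⁻¹ * volume (closedBall (0 : 𝔼) 1)) with hD
  have hDfin : D ≠ ∞ := ENNReal.mul_ne_top ENNReal.ofReal_ne_top
    (ENNReal.mul_ne_top ENNReal.ofReal_ne_top measure_closedBall_lt_top.ne)
  have hlim : Tendsto (fun ε => ∫⁻ y in Ω, (S ε).indicator (fun y => ‖h y‖ₑ) y) (𝓝[>] 0)
      (𝓝 0) := by
    refine tendsto_of_seq_tendsto fun u hu => ?_
    have h0 := tendsto_lintegral_of_dominated_convergence' (μ := volume.restrict Ω)
      (F := fun n => (S (u n)).indicator fun y => ‖h y‖ₑ) (f := fun _ => 0)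
      (fun y => ‖h y‖ₑ) ?_ ?_ hh.2.ne ?_
    · simpa [Function.comp_def] using h0
    · exact fun n => hh.aestronglyMeasurable.enorm.indicator (hSm (u n))
    · exact fun n => Eventually.of_forall fun y => Set.indicator_le_self _ _ _
    · filter_upwards [ae_restrict_mem hm] with y hy
      have hev : ∀ᶠ ε in 𝓝[>] (0 : ℝ), a * ε < d y := by
        have : Tendsto (fun ε : ℝ => a * ε) (𝓝[>] 0) (𝓝 (a * 0)) :=
          ((continuous_const.mul continuous_id).tendsto _).mono_left nhdsWithin_le_nhds
        rw [mul_zero] at this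
        exact this.eventually (gt_mem_nhds (hpos y hy))
      refine tendsto_const_nhds.congr' ?_
      filter_upwards [hu.eventually hev] with n hε
      rw [Set.indicator_of_notMem]
      simpa [hS] using hε
  have hbound : ∀ᶠ ε in 𝓝[>] (0 : ℝ), ∫⁻ x in Ω, ‖∫ y in Ω, h y * r ε x y‖ₑ
      ≤ D * ∫⁻ y in Ω, (S ε).indicator (fun y => ‖h y‖ₑ) y := by
    filter_upwards [Ioc_mem_nhdsGT one_pos] with ε hε
    have hκ : 0 ≤ (mollMass N ε)⁻¹ := inv_nonneg.2 (mollMass_pos hε.1).le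
    set k : ℝ≥0∞ := ENNReal.ofReal C * ENNReal.ofReal (mollMass N ε)⁻¹ with hk
    have hT : MeasurableSet {p : 𝔼 × 𝔼 | dist p.1 p.2 ≤ ε} :=
      (isClosed_le (by fun_prop) continuous_const).measurableSet
    have hmeas : AEMeasurable (fun p : 𝔼 × 𝔼 => (S ε).indicator (fun y => ‖h y‖ₑ) p.2 *
        {p : 𝔼 × 𝔼 | dist p.1 p.2 ≤ ε}.indicator (fun _ => k) p)
        ((volume.restrict Ω).prod (volume.restrict Ω)) := by
      refine AEMeasurable.mul ?_ (measurable_const.indicator hT).aemeasurable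
      exact (hh.aestronglyMeasurable.enorm.indicator (hSm ε)).comp_snd
    calc ∫⁻ x in Ω, ‖∫ y in Ω, h y * r ε x y‖ₑ
        ≤ ∫⁻ x in Ω, ∫⁻ y in Ω, (S ε).indicator (fun y => ‖h y‖ₑ) y *
          {p : 𝔼 × 𝔼 | dist p.1 p.2 ≤ ε}.indicator (fun _ => k) (x, y) := by
          refine lintegral_mono_ae ?_
          filter_upwards [ae_restrict_mem hm] with x hx
          refine (enorm_integral_le_lintegral_enorm _).trans (lintegral_mono_ae ?_)
          filter_upwards [ae_restrict_mem hm] with y hy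
          by_cases h0 : r ε x y = 0
          · simp [h0]
          · obtain ⟨h1, h2⟩ := hr ε hε x hx y hy h0
            rw [Set.indicator_of_mem (show y ∈ S ε from h2),
              Set.indicator_of_mem (by simpa [dist_eq_norm] using h1), enorm_mul]
            gcongr
            rw [hk, ← ENNReal.ofReal_mul' hκ, ← ofReal_norm]
            exact ENNReal.ofReal_le_ofReal (hC ε hε x hx y hy)
      _ = ∫⁻ y in Ω, ∫⁻ x in Ω, (S ε).indicator (fun y => ‖h y‖ₑ) y *
          {p : 𝔼 × 𝔼 | dist p.1 p.2 ≤ ε}.indicator (fun _ => k) (x, y) :=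
          lintegral_lintegral_swap hmeas
      _ ≤ ∫⁻ y in Ω, (S ε).indicator (fun y => ‖h y‖ₑ) y * D := by
          gcongr with y
          have e : ∀ x, {p : 𝔼 × 𝔼 | dist p.1 p.2 ≤ ε}.indicator (fun _ => k) (x, y)
              = (closedBall y ε).indicator (fun _ => k) x := fun x => by
            simp only [Set.indicator, mem_closedBall, Set.mem_ofPred_eq]
          simp only [e]
          rw [lintegral_const_mul _ (measurable_const.indicator measurableSet_closedBall)]
          gcongr
          calc _ ≤ ∫⁻ x, (closedBall y ε).indicator (fun _ => k) x :=
                lintegral_mono' Measure.restrict_le_self le_rfl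
            _ = k * volume (closedBall y ε) :=
                lintegral_indicator_const measurableSet_closedBall k
            _ = D := by
                rw [hk, hD, mul_assoc, inv_mollMass_mul_volume_closedBall hε.1]
      _ = D * ∫⁻ y in Ω, (S ε).indicator (fun y => ‖h y‖ₑ) y := by
          rw [lintegral_mul_const' _ _ hDfin, mul_comm]
  refine tendsto_of_tendsto_of_tendsto_of_le_of_le' tendsto_const_nhds ?_
    (Eventually.of_forall fun _ => zero_le) hbound
  simpa using ENNReal.Tendsto.const_mul hlim (Or.inr hDfin)

/-- A mollifying kernel corrected by an approximate reflection so that it vanishes when one of the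
two points is a zero of `d`. -/
def reflKer (d : 𝔼 → ℝ) (ε : ℝ) (p : 𝔼 × 𝔼) : ℝ :=
  (mollMass N ε)⁻¹ * (cutoff (reflDist 0 d p.2 p.1 / ε ^ 2) - cutoff (reflDist 4 d p.2 p.1 / ε ^ 2))

lemma reflKer_comm (d : 𝔼 → ℝ) (ε : ℝ) (x y : 𝔼) : reflKer d ε (x, y) = reflKer d ε (y, x) := by
  simp only [reflKer, reflDist_comm _ d y x]

lemma reflKer_eq_zero {d : 𝔼 → ℝ} (ε : ℝ) {x : 𝔼} (y : 𝔼) (hx : d x = 0) : reflKer d ε (x, y) = 0 := by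
  simp [reflKer, reflDist, hx]

lemma contDiff_cutoff_reflDist (c : ℝ) {d : 𝔼 → ℝ} (hd : ContDiff ℝ (⊤ : ℕ∞) d) (ε : ℝ) :
    ContDiff ℝ (⊤ : ℕ∞) fun p : 𝔼 × 𝔼 => cutoff (reflDist c d p.2 p.1 / ε ^ 2) :=
  contDiff_cutoff.comp ((contDiff_reflDist c hd).div_const _)

lemma contDiff_reflKer {d : 𝔼 → ℝ} (hd : ContDiff ℝ (⊤ : ℕ∞) d) (ε : ℝ) :
    ContDiff ℝ (⊤ : ℕ∞) (reflKer d ε) :=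
  contDiff_const.mul ((contDiff_cutoff_reflDist 0 hd ε).sub (contDiff_cutoff_reflDist 4 hd ε))

lemma lap_cutoff_reflDist (c : ℝ) {d : 𝔼 → ℝ} (hd : ContDiff ℝ (⊤ : ℕ∞) d) (ε : ℝ) (y x : 𝔼) :
    lap (fun x => cutoff (reflDist c d y x / ε ^ 2)) x =
      deriv (deriv cutoff) (reflDist c d y x / ε ^ 2) / ε ^ 4 * gradSq (reflDist c d y) x
      + deriv cutoff (reflDist c d y x / ε ^ 2) / ε ^ 2 * lap (reflDist c d y) x := by
  have h1 : ContDiff ℝ (⊤ : ℕ∞) (deriv cutoff) := (contDiff_infty_iff_deriv.1 contDiff_cutoff).2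
  have hg : ContDiff ℝ 2 fun s : ℝ => cutoff (s / ε ^ 2) :=
    (contDiff_cutoff.comp (contDiff_id.div_const _)).of_le two_le_infty
  have hq : ContDiff ℝ 2 (reflDist c d y) :=
    ((contDiff_reflDist c hd).comp (contDiff_prodMk_left y)).of_le two_le_infty
  have hdiv : ∀ s : ℝ, HasDerivAt (fun s : ℝ => s / ε ^ 2) (1 / ε ^ 2) s := fun s =>
    (hasDerivAt_id s).div_const _
  have e1 : deriv (fun s : ℝ => cutoff (s / ε ^ 2)) = fun s => deriv cutoff (s / ε ^ 2) / ε ^ 2 := by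
    ext s
    have h := (((contDiff_cutoff.differentiable (by simp)) (s / ε ^ 2)).hasDerivAt.comp s
      (hdiv s)).deriv
    simp only [Function.comp_def] at h
    rw [h]; ring
  have e2 : ∀ s, deriv (fun s : ℝ => deriv cutoff (s / ε ^ 2) / ε ^ 2) s
      = deriv (deriv cutoff) (s / ε ^ 2) / ε ^ 4 := by
    intro s
    have h := ((((h1.differentiable (by simp)) (s / ε ^ 2)).hasDerivAt.comp s
      (hdiv s)).div_const (ε ^ 2)).deriv
    simp only [Function.comp_def] at h
    rw [h]; ring
  rw [lap_comp_real hg hq x, e1, e2]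

/-- The amount by which `reflKer` fails to intertwine the Laplacians in its two variables. -/
def reflKerDefect (d : 𝔼 → ℝ) (ε : ℝ) (x y : 𝔼) : ℝ :=
  lap (fun x => reflKer d ε (x, y)) x - lap (fun y => reflKer d ε (x, y)) y

lemma lap_reflKer {d : 𝔼 → ℝ} (hd : ContDiff ℝ (⊤ : ℕ∞) d) (ε : ℝ) (x y : 𝔼) :
    lap (fun x => reflKer d ε (x, y)) x = (mollMass N ε)⁻¹ *
      (lap (fun x => cutoff (reflDist 0 d y x / ε ^ 2)) x
        - lap (fun x => cutoff (reflDist 4 d y x / ε ^ 2)) x) := by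
  have h : ∀ c, ContDiff ℝ 2 fun x => cutoff (reflDist c d y x / ε ^ 2) := fun c =>
    ((contDiff_cutoff_reflDist c hd ε).comp (contDiff_prodMk_left y)).of_le two_le_infty
  rw [← lap_sub_s17 (h 0) (h 4), ← lap_const_mul ((h 0).sub (h 4))]
  rfl

lemma reflKerDefect_eq {d : 𝔼 → ℝ} (hd : ContDiff ℝ (⊤ : ℕ∞) d) (ε : ℝ) (x y : 𝔼) :
    reflKerDefect d ε x y = -(mollMass N ε)⁻¹ *
      (deriv (deriv cutoff) (reflDist 4 d y x / ε ^ 2) / ε ^ 4 *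
          (gradSq (reflDist 4 d y) x - gradSq (reflDist 4 d x) y)
        + deriv cutoff (reflDist 4 d y x / ε ^ 2) / ε ^ 2 *
          (lap (reflDist 4 d y) x - lap (reflDist 4 d x) y)) := by
  have hd2 := hd.of_le two_le_infty
  have hdd : Differentiable ℝ d := hd.differentiable (by simp)
  have e : (fun y => reflKer d ε (x, y)) = fun y => reflKer d ε (y, x) := funext fun y => reflKer_comm d ε x y
  rw [reflKerDefect, e, lap_reflKer hd, lap_reflKer hd]
  simp only [lap_cutoff_reflDist _ hd, reflDist_comm _ d x y]
  have g0 : gradSq (reflDist 0 d y) x = gradSq (reflDist 0 d x) y := by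
    rw [gradSq_reflDist 0 hdd, gradSq_reflDist 0 hdd, norm_sub_rev]; ring
  have l0 : lap (reflDist 0 d y) x = lap (reflDist 0 d x) y := by
    rw [lap_reflDist 0 hd2, lap_reflDist 0 hd2]; ring
  rw [g0, l0]
  ring

lemma exists_taylor_bound {Ω : Set 𝔼} (hb : Bornology.IsBounded Ω) {d : 𝔼 → ℝ}
    (hd : ContDiff ℝ (⊤ : ℕ∞) d) :
    ∃ L, 0 ≤ L ∧ ∀ x ∈ Ω, ∀ y ∈ Ω, |d x - d y| ≤ L * ‖x - y‖ ∧
      |d x - d y - fderiv ℝ d x (x - y)| ≤ L * ‖x - y‖ ^ 2 := by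
  obtain ⟨R, hR⟩ := hb.subset_closedBall 0
  have h1 : ContDiff ℝ (⊤ : ℕ∞) (fderiv ℝ d) := hd.fderiv_right (by simp)
  have hdd : Differentiable ℝ d := hd.differentiable (by simp)
  have hd1d : Differentiable ℝ (fderiv ℝ d) := h1.differentiable (by simp)
  obtain ⟨L₁, hL₁⟩ := (isCompact_closedBall (0 : 𝔼) R).exists_bound_of_continuousOn
    h1.continuous.continuousOn
  obtain ⟨L₂, hL₂⟩ := (isCompact_closedBall (0 : 𝔼) R).exists_bound_of_continuousOn
    (h1.continuous_fderiv (by simp)).continuousOn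
  have hconv : Convex ℝ (closedBall (0 : 𝔼) R) := convex_closedBall _ _
  refine ⟨max (max L₁ L₂) 0, le_max_right _ _, fun x hx y hy => ⟨?_, ?_⟩⟩
  · have h := hconv.norm_image_sub_le_of_norm_fderiv_le (fun z _ => hdd z) hL₁ (hR hy) (hR hx)
    refine h.trans ?_
    gcongr
    exact (le_max_left _ _).trans (le_max_left _ _)
  · have hL20 : 0 ≤ L₂ := (norm_nonneg _).trans (hL₂ x (hR hx))
    have h := (hconv.inter (convex_closedBall x ‖x - y‖)).norm_image_sub_le_of_norm_fderiv_le'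
      (f := d) (φ := fderiv ℝ d x) (C := L₂ * ‖x - y‖) (fun z _ => hdd z) (fun z hz => by
        refine (hconv.norm_image_sub_le_of_norm_fderiv_le (fun z _ => hd1d z) hL₂ (hR hx)
          hz.1).trans ?_
        gcongr
        exact mem_closedBall_iff_norm.1 hz.2)
      (x := y) (y := x) ⟨hR hy, by simp [dist_eq_norm, norm_sub_rev]⟩ ⟨hR hx, by simp⟩
    refine h.trans ?_
    rw [mul_assoc, ← pow_two]
    gcongr
    exact (le_max_right _ _).trans (le_max_left _ _)

lemma le_of_reflDist_le {d : 𝔼 → ℝ} {L ε : ℝ} {x y : 𝔼} (hL : 0 ≤ L) (hε : 0 < ε) (hx : 0 < d x)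
    (hy : 0 < d y) (hd : |d x - d y| ≤ L * ‖x - y‖) (h : reflDist 4 d y x ≤ ε ^ 2) :
    ‖x - y‖ ≤ ε ∧ d x ≤ (L + 1) * ε ∧ d y ≤ (L + 1) * ε := by
  rw [reflDist] at h
  have hxy : 0 < d y * d x := mul_pos hy hx
  have h1 : ‖x - y‖ ≤ ε := abs_le_of_sq_le_sq' (by nlinarith) hε.le |>.2
  have h2 : |d x - d y| ≤ L * ε := hd.trans (by gcongr)
  obtain ⟨h3, h4⟩ := abs_le.1 h2
  refine ⟨h1, ?_, ?_⟩
  · by_contra! h5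
    nlinarith [sq_nonneg ‖x - y‖]
  · by_contra! h5
    nlinarith [sq_nonneg ‖x - y‖]

lemma reflKerDefect_eq_zero {d : 𝔼 → ℝ} (hd : ContDiff ℝ (⊤ : ℕ∞) d) {ε : ℝ} (hε : 0 < ε)
    {x y : 𝔼} (h : ε ^ 2 < reflDist 4 d y x) : reflKerDefect d ε x y = 0 := by
  have h1 : 1 < reflDist 4 d y x / ε ^ 2 := (one_lt_div (by positivity)).2 h
  simp [reflKerDefect_eq hd, deriv_cutoff_of_one_lt h1, deriv_deriv_cutoff_of_one_lt h1]

lemma exists_reflKerDefect_bound {Ω : Set 𝔼} (hb : Bornology.IsBounded Ω) {d : 𝔼 → ℝ}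
    (hd : ContDiff ℝ (⊤ : ℕ∞) d) (hpos : ∀ x ∈ Ω, 0 < d x) {C : ℝ} (hC0 : 0 ≤ C)
    (hC : ∀ x ∈ Ω, |gradSq d x - 1| ≤ C * d x) :
    ∃ A, 0 ≤ A ∧ ∀ ε, 0 < ε → ∀ x ∈ Ω, ∀ y ∈ Ω,
      (reflDist 4 d y x ≤ ε ^ 2 → ‖x - y‖ ≤ ε ∧ d x ≤ A * ε ∧ d y ≤ A * ε) ∧
      |reflKerDefect d ε x y| ≤ A * (mollMass N ε)⁻¹ / ε := by
  have hd2 := hd.of_le two_le_infty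
  have hdd : Differentiable ℝ d := hd.differentiable (by simp)
  obtain ⟨L, hL, hT⟩ := exists_taylor_bound hb hd
  obtain ⟨B, hB0, hB⟩ := exists_abs_le_of_continuous hb (continuous_lap_s17 hd2)
  obtain ⟨M, hM0, hM⟩ := exists_cutoff_bound
  set a := L + 1 with ha
  have ha0 : 0 ≤ a := by positivity
  set K := M * (16 * (2 * a * L + 2 * C * a ^ 3)) + M * (8 * a * B) with hK
  have hK0 : 0 ≤ K := by positivity
  have key : ∀ ε, 0 < ε → ∀ x ∈ Ω, ∀ y ∈ Ω, reflDist 4 d y x ≤ ε ^ 2 →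
      ‖x - y‖ ≤ ε ∧ d x ≤ a * ε ∧ d y ≤ a * ε := fun ε hε x hx y hy h =>
    le_of_reflDist_le hL hε (hpos x hx) (hpos y hy) (hT x hx y hy).1 h
  refine ⟨max a K, le_max_of_le_left ha0, fun ε hε x hx y hy => ⟨fun h => ?_, ?_⟩⟩
  · obtain ⟨h1, h2, h3⟩ := key ε hε x hx y hy h
    exact ⟨h1, h2.trans (by gcongr; exact le_max_left _ _),
      h3.trans (by gcongr; exact le_max_left _ _)⟩
  have hκ : 0 < (mollMass N ε)⁻¹ := inv_pos.2 (mollMass_pos hε)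
  rcases lt_or_ge (ε ^ 2) (reflDist 4 d y x) with h | h
  · rw [reflKerDefect_eq_zero hd hε h, abs_zero]
    have := le_max_of_le_left (c := K) ha0
    positivity
  obtain ⟨h1, h2, h3⟩ := key ε hε x hx y hy h
  have hdx := hpos x hx
  have hdy := hpos y hy
  have hsq : ‖x - y‖ ^ 2 ≤ ε ^ 2 := by gcongr
  have hG : |gradSq (reflDist 4 d y) x - gradSq (reflDist 4 d x) y|
      ≤ 16 * (2 * a * L + 2 * C * a ^ 3) * ε ^ 3 := by
    rw [gradSq_reflDist 4 hdd, gradSq_reflDist 4 hdd, norm_sub_rev y x]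
    set e₁ := d x - d y - fderiv ℝ d x (x - y) with he₁
    set e₂ := d y - d x - fderiv ℝ d y (y - x) with he₂
    set γ₁ := gradSq d x - 1 with hγ₁
    set γ₂ := gradSq d y - 1 with hγ₂
    have b₁ : |e₁| ≤ L * ε ^ 2 := (hT x hx y hy).2.trans (by gcongr)
    have b₂ : |e₂| ≤ L * ε ^ 2 :=
      (hT y hy x hx).2.trans (by rw [norm_sub_rev]; gcongr)
    have c₁ : |γ₁| ≤ C * (a * ε) := (hC x hx).trans (by gcongr)
    have c₂ : |γ₂| ≤ C * (a * ε) := (hC y hy).trans (by gcongr)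
    have e : 4 * ‖x - y‖ ^ 2 + 4 * (4 * d y) * fderiv ℝ d x (x - y) + (4 * d y) ^ 2 * gradSq d x
        - (4 * ‖x - y‖ ^ 2 + 4 * (4 * d x) * fderiv ℝ d y (y - x) + (4 * d x) ^ 2 * gradSq d y)
        = 16 * (d x * e₂ - d y * e₁ + (d y ^ 2 * γ₁ - d x ^ 2 * γ₂)) := by
      rw [he₁, he₂, hγ₁, hγ₂]; ring
    rw [e, abs_mul, abs_of_pos (by norm_num : (0 : ℝ) < 16), mul_assoc]
    gcongr
    have t₁ : |d x * e₂| ≤ a * ε * (L * ε ^ 2) := by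
      rw [abs_mul, abs_of_pos hdx]; gcongr
    have t₂ : |d y * e₁| ≤ a * ε * (L * ε ^ 2) := by
      rw [abs_mul, abs_of_pos hdy]; gcongr
    have t₃ : |d y ^ 2 * γ₁| ≤ (a * ε) ^ 2 * (C * (a * ε)) := by
      rw [abs_mul, abs_of_nonneg (by positivity : 0 ≤ d y ^ 2)]; gcongr
    have t₄ : |d x ^ 2 * γ₂| ≤ (a * ε) ^ 2 * (C * (a * ε)) := by
      rw [abs_mul, abs_of_nonneg (by positivity : 0 ≤ d x ^ 2)]; gcongr
    calc _ ≤ |d x * e₂| + |d y * e₁| + (|d y ^ 2 * γ₁| + |d x ^ 2 * γ₂|) :=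
          (abs_add_le _ _).trans (add_le_add (abs_sub _ _) (abs_sub _ _))
      _ ≤ a * ε * (L * ε ^ 2) + a * ε * (L * ε ^ 2)
          + ((a * ε) ^ 2 * (C * (a * ε)) + (a * ε) ^ 2 * (C * (a * ε))) := by gcongr
      _ = _ := by ring
  have hLap : |lap (reflDist 4 d y) x - lap (reflDist 4 d x) y| ≤ 8 * a * B * ε := by
    rw [lap_reflDist 4 hd2, lap_reflDist 4 hd2]
    have t₁ : |4 * d y * lap d x| ≤ 4 * (a * ε) * B := by
      rw [abs_mul, abs_of_pos (by positivity : 0 < 4 * d y)]; gcongr; exact hB x hx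
    have t₂ : |4 * d x * lap d y| ≤ 4 * (a * ε) * B := by
      rw [abs_mul, abs_of_pos (by positivity : 0 < 4 * d x)]; gcongr; exact hB y hy
    rw [add_sub_add_left_eq_sub]
    refine (abs_sub _ _).trans ((add_le_add t₁ t₂).trans_eq (by ring))
  have hs : 0 ≤ reflDist 4 d y x / ε ^ 2 := by
    rw [reflDist]; positivity
  obtain ⟨-, m₁, m₂⟩ := hM _ hs
  rw [reflKerDefect_eq hd, abs_mul, abs_neg, abs_of_pos hκ]
  calc _ ≤ (mollMass N ε)⁻¹ * (M / ε ^ 4 * (16 * (2 * a * L + 2 * C * a ^ 3) * ε ^ 3)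
          + M / ε ^ 2 * (8 * a * B * ε)) := by
        gcongr
        refine (abs_add_le _ _).trans ?_
        rw [abs_mul, abs_mul, abs_div, abs_div, abs_of_pos (by positivity : 0 < ε ^ 4),
          abs_of_pos (by positivity : 0 < ε ^ 2)]
        gcongr
    _ = K * (mollMass N ε)⁻¹ / ε := by
        rw [hK]; field_simp
    _ ≤ _ := by gcongr; exact le_max_right _ _

lemma integrable_mul_of_continuous {Ω : Set 𝔼} (hm : MeasurableSet Ω)
    (hb : Bornology.IsBounded Ω) {h : 𝔼 → ℝ} (hh : Integrable h (volume.restrict Ω)) {φ : 𝔼 → ℝ}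
    (hφ : Continuous φ) : Integrable (fun x => h x * φ x) (volume.restrict Ω) := by
  obtain ⟨C, -, hC⟩ := exists_abs_le_of_continuous hb hφ
  refine (hh.norm.mul_const C).mono' (hh.aestronglyMeasurable.mul hφ.aestronglyMeasurable) ?_
  filter_upwards [ae_restrict_mem hm] with x hx
  rw [norm_mul]
  gcongr
  exact hC x hx

lemma integrableOn_of_continuous {Ω : Set 𝔼} (hb : Bornology.IsBounded Ω) {φ : 𝔼 → ℝ}
    (hφ : Continuous φ) : IntegrableOn φ Ω :=
  (hφ.continuousOn.integrableOn_compact hb.isCompact_closure).mono_set subset_closure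

lemma tendsto_lintegral_integral_reflKer_sub {Ω : Set 𝔼} (hm : MeasurableSet Ω)
    (hb : Bornology.IsBounded Ω) {d : 𝔼 → ℝ} (hd : ContDiff ℝ (⊤ : ℕ∞) d)
    (hpos : ∀ x ∈ Ω, 0 < d x) {h : 𝔼 → ℝ} (hh : Integrable h (volume.restrict Ω)) :
    Tendsto (fun ε => ∫⁻ x in Ω, ‖(∫ y in Ω, h y * reflKer d ε (x, y)) - h x‖ₑ)
      (𝓝[>] 0) (𝓝 0) := by
  obtain ⟨L, hL, hT⟩ := exists_taylor_bound hb hd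
  obtain ⟨M, hM0, hM⟩ := exists_cutoff_bound
  set u := Ω.indicator h with hu
  have hui : Integrable u := (integrable_indicator_iff hm).2 hh
  set r : ℝ → 𝔼 → 𝔼 → ℝ := fun ε x y =>
    (mollMass N ε)⁻¹ * cutoff (reflDist 4 d y x / ε ^ 2) with hr
  have hrc : ∀ ε, Continuous fun p : 𝔼 × 𝔼 => r ε p.1 p.2 := fun ε =>
    continuous_const.mul (contDiff_cutoff_reflDist 4 hd ε).continuous
  have hmc : ∀ ε (x : 𝔼), Continuous fun y => moll ε (x - y) := fun ε x =>
    (continuous_moll ε).comp (continuous_const.sub continuous_id)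
  have hrc' : ∀ ε x, Continuous fun y => r ε x y := fun ε x => by
    have := hd.continuous
    have := contDiff_cutoff.continuous
    simp only [hr, reflDist]
    fun_prop
  have h1 := tendsto_lintegral_moll_sub hui
  have h2 := tendsto_lintegral_kernel_strip hm hd.continuous hpos hh r (C := M) (a := L + 1)
    (fun ε hε x hx y hy => by
      have hκ := inv_pos.2 (mollMass_pos (N := N) hε.1)
      have hx := hpos x hx
      have hy := hpos y hy
      rw [hr, abs_mul, abs_of_pos hκ, mul_comm]
      gcongr
      exact (hM _ (by rw [reflDist]; positivity)).1)
    (fun ε hε x hx y hy hne => by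
      have h3 : reflDist 4 d y x ≤ ε ^ 2 := by
        by_contra! h4
        refine hne ?_
        have := hε.1
        simp only [hr, cutoff_of_one_le ((one_le_div (by positivity)).2 h4.le), mul_zero]
      obtain ⟨h4, -, h5⟩ := le_of_reflDist_le hL hε.1 (hpos x hx) (hpos y hy) (hT x hx y hy).1 h3
      exact ⟨h4, h5⟩)
  have hker : ∀ ε x y, reflKer d ε (x, y) = moll ε (x - y) - r ε x y := fun ε x y => by
    simp only [reflKer, moll, hr, reflDist, zero_mul, add_zero, mul_sub]
  have h3 := h1.add h2
  rw [add_zero] at h3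
  refine tendsto_of_tendsto_of_tendsto_of_le_of_le' tendsto_const_nhds h3
    (Eventually.of_forall fun _ => zero_le) ?_
  filter_upwards [self_mem_nhdsWithin] with ε hε
  have hε : 0 < ε := hε
  have hcont : Continuous fun x => ∫ y in Ω, h y * r ε x y :=
    continuous_integral_smul_kernel hm hb hh (hrc ε)
  calc ∫⁻ x in Ω, ‖(∫ y in Ω, h y * reflKer d ε (x, y)) - h x‖ₑ
      ≤ ∫⁻ x in Ω, (‖(∫ y, u y * moll ε (x - y)) - u x‖ₑ + ‖∫ y in Ω, h y * r ε x y‖ₑ) := by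
        refine lintegral_mono_ae ?_
        filter_upwards [ae_restrict_mem hm] with x hx
        have e1 : ∫ y, u y * moll ε (x - y) = ∫ y in Ω, h y * moll ε (x - y) := by
          rw [← integral_indicator hm]
          congr 1 with y
          by_cases hy : y ∈ Ω <;> simp [hu, hy]
        have e2 : ∫ y in Ω, h y * reflKer d ε (x, y)
            = (∫ y in Ω, h y * moll ε (x - y)) - ∫ y in Ω, h y * r ε x y := by
          rw [← integral_sub (integrable_mul_of_continuous hm hb hh (hmc ε x))
            (integrable_mul_of_continuous hm hb hh (hrc' ε x))]
          congr 1 with y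
          rw [hker, mul_sub]
        have e3 : u x = h x := Set.indicator_of_mem hx h
        rw [e1, e2, e3, sub_right_comm]
        exact enorm_sub_le
    _ = (∫⁻ x in Ω, ‖(∫ y, u y * moll ε (x - y)) - u x‖ₑ)
          + ∫⁻ x in Ω, ‖∫ y in Ω, h y * r ε x y‖ₑ :=
        lintegral_add_right _ hcont.measurable.enorm
    _ ≤ _ := by
        gcongr
        exact Measure.restrict_le_self

lemma tendsto_lintegral_integral_reflKerDefect {Ω : Set 𝔼} (hm : MeasurableSet Ω)
    (hb : Bornology.IsBounded Ω) {d : 𝔼 → ℝ} (hd : ContDiff ℝ (⊤ : ℕ∞) d)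
    (hpos : ∀ x ∈ Ω, 0 < d x) {C : ℝ} (hC0 : 0 ≤ C) (hC : ∀ x ∈ Ω, |gradSq d x - 1| ≤ C * d x)
    {φ : 𝔼 → ℝ} (hφ0 : ∀ x ∈ Ω, 0 ≤ φ x) {M : ℝ} (hM0 : 0 ≤ M) (hM : ∀ x ∈ Ω, φ x ≤ M * d x)
    {h : 𝔼 → ℝ} (hh : Integrable h (volume.restrict Ω)) :
    Tendsto (fun ε => ∫⁻ x in Ω, ‖φ x * ∫ y in Ω, h y * reflKerDefect d ε x y‖ₑ)
      (𝓝[>] 0) (𝓝 0) := by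
  obtain ⟨A, hA0, hA⟩ := exists_reflKerDefect_bound hb hd hpos hC0 hC
  have h1 := tendsto_lintegral_kernel_strip hm hd.continuous hpos hh
    (fun ε x y => φ x * reflKerDefect d ε x y) (C := M * A * A) (a := A)
    (fun ε hε x hx y hy => by
      have hκ := inv_pos.2 (mollMass_pos (N := N) hε.1)
      have hε0 := hε.1
      obtain ⟨h1, h2⟩ := hA ε hε0 x hx y hy
      rcases lt_or_ge (ε ^ 2) (reflDist 4 d y x) with h | h
      · simp only [reflKerDefect_eq_zero hd hε0 h, mul_zero, abs_zero]
        positivity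
      · rw [abs_mul, abs_of_nonneg (hφ0 x hx)]
        calc _ ≤ (M * (A * ε)) * (A * (mollMass N ε)⁻¹ / ε) := by
              gcongr
              exact (hM x hx).trans (by gcongr; exact (h1 h).2.1)
          _ = _ := by field_simp)
    (fun ε hε x hx y hy hne => by
      have h3 : reflDist 4 d y x ≤ ε ^ 2 := by
        by_contra! h4
        exact hne (by simp only [reflKerDefect_eq_zero hd hε.1 h4, mul_zero])
      obtain ⟨h4, -, h5⟩ := (hA ε hε.1 x hx y hy).1 h3
      exact ⟨h4, h5⟩)
  refine h1.congr fun ε => lintegral_congr fun x => ?_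
  rw [← integral_const_mul]
  congr 2 with y
  ring

lemma lap_zero (x : 𝔼) : lap (fun _ : 𝔼 => (0 : ℝ)) x = 0 := by
  simpa using lap_const_mul (φ := fun _ : 𝔼 => (0 : ℝ)) contDiff_const 0 x

lemma continuous_lap_cutoff_reflDist (c : ℝ) {d : 𝔼 → ℝ} (hd : ContDiff ℝ (⊤ : ℕ∞) d) (ε : ℝ)
    (x : 𝔼) : Continuous fun y => lap (fun x => cutoff (reflDist c d y x / ε ^ 2)) x := by
  have hd2 := hd.of_le two_le_infty
  have hdd : Differentiable ℝ d := hd.differentiable (by simp)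
  have h1 : ContDiff ℝ (⊤ : ℕ∞) (deriv cutoff) := (contDiff_infty_iff_deriv.1 contDiff_cutoff).2
  have c1 := h1.continuous
  have c2 : Continuous (deriv (deriv cutoff)) := h1.continuous_deriv (by simp)
  have cd := hd.continuous
  have c3 : Continuous fun y => reflDist c d y x := by
    simp only [reflDist]
    fun_prop
  simp only [lap_cutoff_reflDist c hd, gradSq_reflDist c hdd, lap_reflDist c hd2]
  fun_prop

lemma lap_integral_reflKer {Ω : Set 𝔼} (hm : MeasurableSet Ω)
    (hb : Bornology.IsBounded Ω) {d : 𝔼 → ℝ} (hd : ContDiff ℝ (⊤ : ℕ∞) d)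
    {h : 𝔼 → ℝ} (hh : Integrable h (volume.restrict Ω)) (ε : ℝ) (x : 𝔼) :
    lap (fun x => ∫ y in Ω, h y * reflKer d ε (x, y)) x
      = (∫ y in Ω, h y * lap (fun y => reflKer d ε (x, y)) y)
        + ∫ y in Ω, h y * reflKerDefect d ε x y := by
  have hk2 : ContDiff ℝ 2 (reflKer d ε) := (contDiff_reflKer hd ε).of_le two_le_infty
  have c1 : Continuous fun y => lap (fun x => reflKer d ε (x, y)) x := by
    simp only [lap_reflKer hd]
    exact continuous_const.mul ((continuous_lap_cutoff_reflDist 0 hd ε x).sub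
      (continuous_lap_cutoff_reflDist 4 hd ε x))
  have c2 : Continuous fun y => lap (fun y => reflKer d ε (x, y)) y :=
    continuous_lap_s17 (hk2.comp (contDiff_prodMk_right x))
  rw [(contDiff_two_integral_kernel hm hb hh hk2).2 x, ← integral_add
    (integrable_mul_of_continuous hm hb hh c2)
    (integrable_mul_of_continuous hm hb hh
      (φ := fun y => reflKerDefect d ε x y) (c1.sub c2))]
  congr 1 with y
  rw [reflKerDefect]
  ring

/-- A convex smooth approximation of the positive part. -/
def smoothPos (s : ℝ) : ℝ := ∫ t in (0 : ℝ)..s, Real.smoothTransition t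

lemma deriv_smoothPos : deriv smoothPos = Real.smoothTransition :=
  funext fun s => Continuous.deriv_integral _ Real.smoothTransition.continuous 0 s

lemma differentiable_smoothPos : Differentiable ℝ smoothPos := fun s =>
  (Real.smoothTransition.continuous.integral_hasStrictDerivAt 0 s).hasDerivAt.differentiableAt

lemma contDiff_smoothPos : ContDiff ℝ 2 smoothPos := by
  rw [show (2 : WithTop ℕ∞) = 1 + 1 by norm_num, contDiff_succ_iff_deriv]
  refine ⟨differentiable_smoothPos, by simp, ?_⟩
  rw [deriv_smoothPos]
  exact Real.smoothTransition.contDiff (n := 1)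

lemma smoothPos_of_nonpos {s : ℝ} (hs : s ≤ 0) : smoothPos s = 0 := by
  rw [smoothPos, intervalIntegral.integral_symm, intervalIntegral.integral_of_le hs,
    setIntegral_eq_zero_of_forall_eq_zero, neg_zero]
  exact fun t ht => Real.smoothTransition.zero_of_nonpos ht.2

lemma smoothPos_pos {s : ℝ} (hs : 0 < s) : 0 < smoothPos s :=
  intervalIntegral.intervalIntegral_pos_of_pos_on
    (Real.smoothTransition.continuous.intervalIntegrable 0 s)
    (fun _ ht => Real.smoothTransition.pos_of_pos ht.1) hs

lemma smoothPos_nonneg (s : ℝ) : 0 ≤ smoothPos s := by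
  rcases le_or_gt s 0 with h | h
  · exact (smoothPos_of_nonpos h).ge
  · exact (smoothPos_pos h).le

lemma abs_smoothPos_sub_le (s t : ℝ) : |smoothPos s - smoothPos t| ≤ |s - t| := by
  have h := convex_univ.norm_image_sub_le_of_norm_deriv_le (f := smoothPos) (C := 1)
    (fun z _ => differentiable_smoothPos z) (fun z _ => by
      rw [deriv_smoothPos, Real.norm_of_nonneg (Real.smoothTransition.nonneg z)]
      exact Real.smoothTransition.le_one z) (Set.mem_univ t) (Set.mem_univ s)
  simpa using h

/-- Kato's inequality for functions vanishing on the boundary. -/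
lemma integral_deriv_comp_mul_lap_mul_le {Ω : Set 𝔼} (ho : IsOpen Ω)
    (hb : Bornology.IsBounded Ω) {u φ : 𝔼 → ℝ} (hu : ContDiff ℝ 2 u)
    (hu0 : ∀ x ∈ frontier Ω, u x = 0) (hφ : ContDiff ℝ 2 φ) (hφ0 : ∀ x ∈ Ω, 0 ≤ φ x)
    {g : ℝ → ℝ} (hg : ContDiff ℝ 2 g) {δ : ℝ} (hδ : 0 < δ) (hg0 : ∀ s < δ, g s = 0)
    (hg2 : ∀ s, 0 ≤ deriv (deriv g) s) :
    ∫ x in Ω, deriv g (u x) * lap u x * φ x ≤ ∫ x in Ω, g (u x) * lap φ x := by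
  have hgu : ContDiff ℝ 2 fun x => g (u x) := hg.comp hu
  set U : 𝔼 → ℝ := Ω.indicator fun x => g (u x) with hU
  have hin : ∀ x ∈ Ω, U =ᶠ[𝓝 x] fun x => g (u x) := fun x hx => by
    filter_upwards [ho.mem_nhds hx] with y hy using Set.indicator_of_mem hy _
  have hout : ∀ x ∉ Ω, U =ᶠ[𝓝 x] fun _ => 0 := fun x hx => by
    by_cases hxc : x ∈ closure Ω
    · have hux : u x = 0 := hu0 x (by rw [ho.frontier_eq]; exact ⟨hxc, hx⟩)
      have : ∀ᶠ y in 𝓝 x, u y < δ :=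
        hu.continuous.continuousAt.eventually (gt_mem_nhds (by rwa [hux]))
      filter_upwards [this] with y hy
      simp [hU, hg0 _ hy]
    · filter_upwards [isClosed_closure.isOpen_compl.mem_nhds hxc] with y hy
      exact Set.indicator_of_notMem (fun h => hy (subset_closure h)) _
  have hU2 : ContDiff ℝ 2 U := by
    rw [contDiff_iff_contDiffAt]
    intro x
    by_cases hx : x ∈ Ω
    · exact hgu.contDiffAt.congr_of_eventuallyEq (hin x hx)
    · exact contDiffAt_const.congr_of_eventuallyEq (hout x hx)
  have hUc : HasCompactSupport U := HasCompactSupport.intro hb.isCompact_closure fun x hx =>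
    Set.indicator_of_notMem (fun h => hx (subset_closure h)) _
  have hg1 : Continuous (deriv g) := hg.continuous_deriv (by norm_num)
  have e := integral_mul_lap_comm hU2 hφ hUc
  have cu := hu.continuous
  have cl := continuous_lap_s17 hu
  have cφ := hφ.continuous
  have e1 : ∫ x, U x * lap φ x = ∫ x in Ω, g (u x) * lap φ x := by
    rw [← integral_indicator ho.measurableSet]
    congr 1 with x
    by_cases hx : x ∈ Ω <;> simp [hU, hx]
  have e2 : ∫ x, lap U x * φ x = ∫ x in Ω, lap (fun x => g (u x)) x * φ x := by
    rw [← integral_indicator ho.measurableSet]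
    congr 1 with x
    by_cases hx : x ∈ Ω
    · simp [hx, lap_congr_of_eventuallyEq (hin x hx)]
    · simp [hx, lap_congr_of_eventuallyEq (hout x hx), lap_zero]
  rw [← e1, e, e2]
  refine setIntegral_mono_on (integrableOn_of_continuous hb (by fun_prop))
    (integrableOn_of_continuous hb ((continuous_lap_s17 hgu).mul cφ)) ho.measurableSet fun x hx => ?_
  refine mul_le_mul_of_nonneg_right ?_ (hφ0 x hx)
  rw [lap_comp_real hg hu]
  exact le_add_of_nonneg_left (mul_nonneg (hg2 _) (gradSq_nonneg _ _))

lemma ae_le_of_forall_integral_smoothPos_le {Ω : Set 𝔼} (hm : MeasurableSet Ω)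
    (hb : Bornology.IsBounded Ω) {w g φ : 𝔼 → ℝ} (hw : Integrable w (volume.restrict Ω))
    (hg : Integrable g (volume.restrict Ω)) (hφ : Continuous φ) (hφ0 : ∀ x ∈ Ω, 0 ≤ φ x)
    {W G D : ℕ → 𝔼 → ℝ} (hWc : ∀ n, Continuous (W n)) (hGc : ∀ n, Continuous (G n))
    (hDc : ∀ n, Continuous (D n)) {c δ : ℝ} (hc : 0 < c)
    (hWae : ∀ᵐ x ∂volume.restrict Ω, Tendsto (fun n => W n x) atTop (𝓝 (w x)))
    (hWL : Tendsto (fun n => ∫⁻ x in Ω, ‖W n x - w x‖ₑ) atTop (𝓝 0))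
    (hGL : Tendsto (fun n => ∫⁻ x in Ω, ‖G n x - g x‖ₑ) atTop (𝓝 0))
    (hDL : Tendsto (fun n => ∫⁻ x in Ω, ‖φ x * D n x‖ₑ) atTop (𝓝 0))
    (hle : ∀ n, c * ∫ x in Ω, smoothPos (W n x - δ)
      ≤ (∫ x in Ω, Real.smoothTransition (W n x - δ) * (φ x * G n x))
        - ∫ x in Ω, Real.smoothTransition (W n x - δ) * (φ x * D n x))
    (hsign : ∀ᵐ x ∂volume.restrict Ω, δ < w x → g x ≤ 0) :
    ∀ᵐ x ∂volume.restrict Ω, w x ≤ δ := by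
  obtain ⟨B, hB0, hB⟩ := exists_abs_le_of_continuous hb hφ
  have cP : Continuous smoothPos := contDiff_smoothPos.continuous
  have cT : Continuous Real.smoothTransition := Real.smoothTransition.continuous
  have cTW : ∀ n, Continuous fun x => Real.smoothTransition (W n x - δ) :=
    fun n => cT.comp ((hWc n).sub continuous_const)
  have hfin : IsFiniteMeasure (volume.restrict Ω) := ⟨by
    simpa using hb.measure_lt_top⟩
  have hT1 : ∀ s, ‖Real.smoothTransition s‖ₑ ≤ 1 := fun s => by
    rw [← ofReal_norm, Real.norm_of_nonneg (Real.smoothTransition.nonneg s)]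
    exact ENNReal.ofReal_le_one.2 (Real.smoothTransition.le_one s)
  have hgφ : Integrable (fun x => φ x * g x) (volume.restrict Ω) :=
    (integrable_mul_of_continuous hm hb hg hφ).congr (ae_of_all _ fun x => mul_comm _ _)
  have hPint : Integrable (fun x => smoothPos (w x - δ)) (volume.restrict Ω) := by
    refine (hw.sub (integrable_const δ)).mono
      (cP.comp_aestronglyMeasurable (hw.sub (integrable_const δ)).aestronglyMeasurable)
      (ae_of_all _ fun x => ?_)
    simpa [smoothPos_of_nonpos le_rfl] using abs_smoothPos_sub_le (w x - δ) 0
  have l1 : Tendsto (fun n => ∫ x in Ω, smoothPos (W n x - δ)) atTop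
      (𝓝 (∫ x in Ω, smoothPos (w x - δ))) := by
    refine tendsto_integral_of_L1 _ hPint.aestronglyMeasurable (Eventually.of_forall fun n =>
      integrableOn_of_continuous hb (cP.comp ((hWc n).sub continuous_const))) ?_
    refine tendsto_of_tendsto_of_tendsto_of_le_of_le tendsto_const_nhds hWL
      (fun _ => zero_le) fun n => lintegral_mono fun x => ?_
    rw [← ofReal_norm, ← ofReal_norm]
    refine ENNReal.ofReal_le_ofReal ((abs_smoothPos_sub_le _ _).trans_eq ?_)
    rw [sub_sub_sub_cancel_right, Real.norm_eq_abs]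
  have l2 : Tendsto (fun n => ∫ x in Ω, Real.smoothTransition (W n x - δ) * (φ x * D n x)) atTop
      (𝓝 (∫ x in Ω, (0 : ℝ))) := by
    refine tendsto_integral_of_L1 _ aestronglyMeasurable_const (Eventually.of_forall fun n =>
      integrableOn_of_continuous hb
        ((cTW n).mul (hφ.mul (hDc n)))) ?_
    refine tendsto_of_tendsto_of_tendsto_of_le_of_le tendsto_const_nhds hDL
      (fun _ => zero_le) fun n => lintegral_mono fun x => ?_
    rw [sub_zero, enorm_mul]
    exact mul_le_of_le_one_left' (hT1 _)
  have l3 : Tendsto (fun n => ∫ x in Ω, Real.smoothTransition (W n x - δ) * (φ x * (G n x - g x)))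
      atTop (𝓝 (∫ x in Ω, (0 : ℝ))) := by
    refine tendsto_integral_of_L1 _ aestronglyMeasurable_const (Eventually.of_forall fun n => ?_) ?_
    · have h1 := integrableOn_of_continuous hb (hGc n) |>.sub hg
      have h2 := integrable_mul_of_continuous hm hb h1 ((cTW n).mul hφ)
      refine h2.congr (ae_of_all _ fun x => ?_)
      simp only [Pi.sub_apply, Pi.mul_apply]
      ring
    · have h1 := ENNReal.Tendsto.const_mul hGL (Or.inr (ENNReal.ofReal_ne_top (r := B)))
      rw [mul_zero] at h1
      refine tendsto_of_tendsto_of_tendsto_of_le_of_le tendsto_const_nhds h1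
        (fun _ => zero_le) fun n => ?_
      beta_reduce
      rw [← lintegral_const_mul' _ _ ENNReal.ofReal_ne_top]
      refine lintegral_mono_ae ?_
      filter_upwards [ae_restrict_mem hm] with x hx
      rw [sub_zero, enorm_mul, enorm_mul]
      refine (mul_le_of_le_one_left' (hT1 _)).trans ?_
      gcongr
      rw [← ofReal_norm]
      exact ENNReal.ofReal_le_ofReal (hB x hx)
  have l4 : Tendsto (fun n => ∫ x in Ω, Real.smoothTransition (W n x - δ) * (φ x * g x)) atTop
      (𝓝 (∫ x in Ω, Real.smoothTransition (w x - δ) * (φ x * g x))) := by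
    refine tendsto_integral_of_dominated_convergence (fun x => ‖φ x * g x‖) (fun n => ?_)
      hgφ.norm (fun n => ae_of_all _ fun x => ?_) ?_
    · exact (cTW n).aestronglyMeasurable.mul
        hgφ.aestronglyMeasurable
    · rw [norm_mul, Real.norm_of_nonneg (Real.smoothTransition.nonneg _)]
      exact mul_le_of_le_one_left (norm_nonneg _) (Real.smoothTransition.le_one _)
    · filter_upwards [hWae] with x hx
      exact ((cT.tendsto _).comp (hx.sub_const δ)).mul_const _
  have hle' : ∀ n, c * ∫ x in Ω, smoothPos (W n x - δ)
      ≤ ((∫ x in Ω, Real.smoothTransition (W n x - δ) * (φ x * (G n x - g x)))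
        + ∫ x in Ω, Real.smoothTransition (W n x - δ) * (φ x * g x))
        - ∫ x in Ω, Real.smoothTransition (W n x - δ) * (φ x * D n x) := fun n => by
    refine (hle n).trans_eq ?_
    congr 1
    have i1 : Integrable (fun x => Real.smoothTransition (W n x - δ) * (φ x * g x))
        (volume.restrict Ω) := (integrable_mul_of_continuous hm hb hgφ
          (cTW n)).congr (ae_of_all _ fun x => mul_comm _ _)
    have i2 : Integrable (fun x => Real.smoothTransition (W n x - δ) * (φ x * G n x))
        (volume.restrict Ω) := integrableOn_of_continuous hb
        ((cTW n).mul (hφ.mul (hGc n)))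
    rw [← sub_eq_iff_eq_add, ← integral_sub i2 i1]
    congr 1 with x
    ring
  have hlim := le_of_tendsto_of_tendsto' (l1.const_mul c) ((l3.add l4).sub l2) hle'
  have hneg : ∫ x in Ω, Real.smoothTransition (w x - δ) * (φ x * g x) ≤ 0 := by
    refine integral_nonpos_of_ae ?_
    filter_upwards [hsign, ae_restrict_mem hm] with x hx hxm
    rcases le_or_gt (w x) δ with h | h
    · simp [Real.smoothTransition.zero_of_nonpos (sub_nonpos.2 h)]
    · exact mul_nonpos_of_nonneg_of_nonpos (Real.smoothTransition.nonneg _)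
        (mul_nonpos_of_nonneg_of_nonpos (hφ0 x hxm) (hx h))
  have hzero : ∫ x in Ω, smoothPos (w x - δ) = 0 := by
    refine le_antisymm ?_ (integral_nonneg fun x => smoothPos_nonneg _)
    simp only [integral_zero, zero_add, sub_zero] at hlim
    exact nonpos_of_mul_nonpos_right (hlim.trans hneg) hc
  have hae := (integral_eq_zero_iff_of_nonneg (fun x => smoothPos_nonneg _) hPint).1 hzero
  filter_upwards [hae] with x hx
  by_contra! h
  exact (smoothPos_pos (sub_pos.2 h)).ne' hx

/-- Weak maximum principle for `L¹` solutions of the Dirichlet problem. -/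
lemma ae_nonpos_of_forall_integral_mul_neg_lap_eq (hN : 0 < N) {Ω : Set 𝔼}
    (hΩ : SmoothBoundedDomain Ω) {w g : 𝔼 → ℝ} (hw : Integrable w (volume.restrict Ω))
    (hg : Integrable g (volume.restrict Ω))
    (heq : ∀ φ : 𝔼 → ℝ, ContDiff ℝ (⊤ : ℕ∞) φ → (∀ x ∈ frontier Ω, φ x = 0) →
      ∫ x in Ω, w x * -lap φ x = ∫ x in Ω, g x * φ x)
    (hsign : ∀ᵐ x ∂volume.restrict Ω, 0 < w x → g x ≤ 0) :
    ∀ᵐ x ∂volume.restrict Ω, w x ≤ 0 := by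
  obtain ⟨d, hd, hpos, hfr, C, hC0, hC⟩ := hΩ.exists_normalized
  obtain ⟨ho, hb, -⟩ := hΩ
  have hm := ho.measurableSet
  obtain ⟨φ, hφ, -, hφ0, ⟨M, hM0, hM⟩, c, hc, hcφ⟩ := exists_barrier hN hb hd hpos hfr hC0 hC
  have hφ2 : ContDiff ℝ 2 φ := hφ.of_le two_le_infty
  set W : ℝ → 𝔼 → ℝ := fun ε x => ∫ y in Ω, w y * reflKer d ε (x, y) with hW
  set G : ℝ → 𝔼 → ℝ := fun ε x => ∫ y in Ω, g y * reflKer d ε (x, y) with hG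
  set D : ℝ → 𝔼 → ℝ := fun ε x => ∫ y in Ω, w y * reflKerDefect d ε x y with hD
  have hk2 : ∀ ε, ContDiff ℝ 2 (reflKer d ε) := fun ε => (contDiff_reflKer hd ε).of_le two_le_infty
  have hW2 : ∀ ε, ContDiff ℝ 2 (W ε) := fun ε => (contDiff_two_integral_kernel hm hb hw (hk2 ε)).1
  have hGc : ∀ ε, Continuous (G ε) := fun ε =>
    (contDiff_two_integral_kernel hm hb hg (hk2 ε)).1.continuous
  have hlap : ∀ ε x, lap (W ε) x = -G ε x + D ε x := fun ε x => by
    have h1 := heq (fun y => reflKer d ε (x, y)) ((contDiff_reflKer hd ε).comp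
      (contDiff_prodMk_right x)) fun y hy => by
        rw [reflKer_comm, reflKer_eq_zero ε x (hfr y hy)]
    simp only [mul_neg, integral_neg] at h1
    simp only [hW, hG, hD]
    rw [lap_integral_reflKer hm hb hd hw, ← h1, neg_neg]
  have hDc : ∀ ε, Continuous (D ε) := fun ε => by
    have e : D ε = fun x => lap (W ε) x + G ε x := funext fun x => by rw [hlap]; ring
    rw [e]
    exact (continuous_lap_s17 (hW2 ε)).add (hGc ε)
  have hW0 : ∀ ε, ∀ x ∈ frontier Ω, W ε x = 0 := fun ε x hx => by
    simp [hW, reflKer_eq_zero ε _ (hfr x hx)]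
  have hWL := tendsto_lintegral_integral_reflKer_sub hm hb hd hpos hw
  have hGL := tendsto_lintegral_integral_reflKer_sub hm hb hd hpos hg
  have hDL := tendsto_lintegral_integral_reflKerDefect hm hb hd hpos hC0 hC hφ0 hM0 hM hw
  have hmeas : TendstoInMeasure (volume.restrict Ω) W (𝓝[>] 0) w := by
    refine tendstoInMeasure_of_tendsto_eLpNorm one_ne_zero
      (fun ε => (hW2 ε).continuous.aestronglyMeasurable) hw.aestronglyMeasurable ?_
    simpa only [eLpNorm_one_eq_lintegral_enorm, Pi.sub_apply] using hWL
  obtain ⟨e, he, hae⟩ := hmeas.exists_seq_tendsto_ae'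
  have cP := contDiff_smoothPos
  have cT : Continuous Real.smoothTransition := Real.smoothTransition.continuous
  have key : ∀ δ > 0, ∀ᵐ x ∂volume.restrict Ω, w x ≤ δ := fun δ hδ => by
    refine ae_le_of_forall_integral_smoothPos_le hm hb hw hg hφ.continuous hφ0
      (fun n => (hW2 (e n)).continuous) (fun n => hGc (e n)) (fun n => hDc (e n)) hc hae
      (hWL.comp he) (hGL.comp he) (hDL.comp he) (fun n => ?_) ?_
    · have hcW := (hW2 (e n)).continuous
      have hcD := hDc (e n)
      have hcG := hGc (e n)
      have hcφ' := hφ.continuous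
      have hder : deriv (fun s => smoothPos (s - δ)) = fun s => Real.smoothTransition (s - δ) := by
        ext s
        rw [deriv_comp_sub_const, deriv_smoothPos]
      have h1 := integral_deriv_comp_mul_lap_mul_le ho hb (hW2 (e n)) (hW0 (e n)) hφ2 hφ0
        (g := fun s => smoothPos (s - δ)) (cP.comp (contDiff_id.sub contDiff_const)) hδ
        (fun s hs => smoothPos_of_nonpos (sub_nonpos.2 hs.le)) (fun s => by
          rw [hder, deriv_comp_sub_const]
          exact Real.smoothTransition.monotone.deriv_nonneg)
      rw [hder] at h1
      have h2 : c * ∫ x in Ω, smoothPos (W (e n) x - δ)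
          ≤ -∫ x in Ω, smoothPos (W (e n) x - δ) * lap φ x := by
        have cPW : Continuous fun x => smoothPos (W (e n) x - δ) :=
          cP.continuous.comp (hcW.sub continuous_const)
        rw [← integral_const_mul, ← integral_neg]
        refine setIntegral_mono_on (integrableOn_of_continuous hb (continuous_const.mul cPW))
          (integrableOn_of_continuous hb (cPW.mul (continuous_lap_s17 hφ2)).neg) hm fun x hx => ?_
        nlinarith [hcφ x hx, smoothPos_nonneg (W (e n) x - δ)]
      refine h2.trans ((neg_le_neg h1).trans_eq ?_)
      have cTW : Continuous fun x => Real.smoothTransition (W (e n) x - δ) :=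
        cT.comp (hcW.sub continuous_const)
      have i1 : IntegrableOn
          (fun x => Real.smoothTransition (W (e n) x - δ) * (φ x * G (e n) x)) Ω :=
        integrableOn_of_continuous hb (cTW.mul (hcφ'.mul hcG))
      have i2 : IntegrableOn
          (fun x => Real.smoothTransition (W (e n) x - δ) * (φ x * D (e n) x)) Ω :=
        integrableOn_of_continuous hb (cTW.mul (hcφ'.mul hcD))
      rw [← integral_sub i1 i2, ← integral_neg]
      congr 1 with x
      rw [hlap]
      ring
    · filter_upwards [hsign] with x hx h using hx (hδ.trans h)
  have hall : ∀ᵐ x ∂volume.restrict Ω, ∀ n : ℕ, w x ≤ 1 / ((n : ℝ) + 1) :=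
    ae_all_iff.2 fun n => key _ (by positivity)
  filter_upwards [hall] with x hx
  exact ge_of_tendsto' tendsto_one_div_add_atTop_nhds_zero_nat hx

lemma volume_restrict_eq_zero_of_isLSWSolFun_one (hN : N = 0) {Ω : Set 𝔼} {ζ : 𝔼 → ℝ}
    (hb : Bornology.IsBounded Ω) (hζ : IsLSWSolFun Ω (fun _ => 0) (fun _ => 1) ζ) :
    volume.restrict Ω = 0 := by
  subst hN
  have h := hζ.2.2 (fun _ => 1) contDiff_const fun x hx => by
    simp at hx
  have hfin := hb.measure_lt_top (μ := volume)
  simp only [lap, Finset.univ_eq_empty, Finset.sum_empty, neg_zero, add_zero, mul_zero,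
    integral_zero, mul_one, integral_const, smul_eq_mul, Measure.real, Measure.restrict_apply_univ]
    at h
  rw [Measure.restrict_eq_zero]
  exact ((ENNReal.toReal_eq_zero_iff _).1 h.symm).resolve_right hfin.ne

/-- **Uniform bound on solutions with bounded data** (from the proof of Proposition 4.3).
Let `Ω` be a smooth bounded open set, `V ∈ L¹(Ω)` nonnegative, and `f` measurable with
`0 ≤ f ≤ 1` a.e. If `v` solves `-Δv + Vv = f` in `Ω`, `v = 0` on `∂Ω`, and `ζ` solves
`-Δζ = 1` in `Ω`, `ζ = 0` on `∂Ω`, both in the sense of Littman–Stampacchia–Weinberger,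
then `v ≤ ζ` a.e. in `Ω`. -/
theorem comparison_with_torsion_function
    (Ω : Set (EuclideanSpace ℝ (Fin N))) (hΩ : SmoothBoundedDomain Ω)
    (V : EuclideanSpace ℝ (Fin N) → ℝ)
    (hV : Integrable V (volume.restrict Ω))
    (hV0 : ∀ᵐ x ∂(volume.restrict Ω), 0 ≤ V x)
    (f : EuclideanSpace ℝ (Fin N) → ℝ) (hf : Measurable f)
    (hf0 : ∀ᵐ x ∂(volume.restrict Ω), 0 ≤ f x)
    (hf1 : ∀ᵐ x ∂(volume.restrict Ω), f x ≤ 1)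
    (v : EuclideanSpace ℝ (Fin N) → ℝ) (hv : IsLSWSolFun Ω V f v)
    (ζ : EuclideanSpace ℝ (Fin N) → ℝ)
    (hζ : IsLSWSolFun Ω (fun _ => 0) (fun _ => 1) ζ) :
    ∀ᵐ x ∂(volume.restrict Ω), v x ≤ ζ x := by
  obtain ⟨ho, hb, -⟩ := id hΩ
  have hm := ho.measurableSet
  rcases Nat.eq_zero_or_pos N with hN | hN
  · simp [volume_restrict_eq_zero_of_isLSWSolFun_one hN hb hζ]
  have hfin : IsFiniteMeasure (volume.restrict Ω) := ⟨by simpa using hb.measure_lt_top⟩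
  have hfi : Integrable f (volume.restrict Ω) := by
    refine (integrable_const (1 : ℝ)).mono' hf.aestronglyMeasurable ?_
    filter_upwards [hf0, hf1] with x h0 h1
    rwa [Real.norm_of_nonneg h0]
  obtain ⟨hvi, hVvi, hveq⟩ := hv
  obtain ⟨hζi, -, hζeq⟩ := hζ
  have hv' : ∀ φ : EuclideanSpace ℝ (Fin N) → ℝ, ContDiff ℝ (⊤ : ℕ∞) φ →
      (∀ x ∈ frontier Ω, φ x = 0) →
      ∫ x in Ω, v x * lap φ x = ∫ x in Ω, (V x * v x - f x) * φ x := fun φ hφ h0 => by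
    have cφ := hφ.continuous
    have i1 := integrable_mul_of_continuous hm hb hvi (continuous_lap_s17 (hφ.of_le two_le_infty))
    have i2 := integrable_mul_of_continuous hm hb hVvi cφ
    have i3 := integrable_mul_of_continuous hm hb hfi cφ
    have h1 := hveq φ hφ h0
    have e1 : ∫ x in Ω, v x * (-(lap φ x) + V x * φ x)
        = (∫ x in Ω, V x * v x * φ x) - ∫ x in Ω, v x * lap φ x := by
      rw [← integral_sub i2 i1]
      congr 1 with x
      ring
    have e2 : ∫ x in Ω, (V x * v x - f x) * φ x
        = (∫ x in Ω, V x * v x * φ x) - ∫ x in Ω, φ x * f x := by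
      simp only [mul_comm (φ _)]
      rw [← integral_sub i2 i3]
      congr 1 with x
      ring
    linarith
  have hv0 : ∀ᵐ x ∂(volume.restrict Ω), -v x ≤ 0 := by
    refine ae_nonpos_of_forall_integral_mul_neg_lap_eq hN hΩ hvi.neg (hVvi.sub hfi)
      (fun φ hφ h0 => ?_) ?_
    · simpa using hv' φ hφ h0
    · filter_upwards [hV0, hf0] with x hVx hfx hx
      simp only [Pi.sub_apply] at hx ⊢
      nlinarith
  have hvζ : ∀ᵐ x ∂(volume.restrict Ω), v x - ζ x ≤ 0 := by
    refine ae_nonpos_of_forall_integral_mul_neg_lap_eq hN hΩ (w := fun x => v x - ζ x)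
      (g := fun x => f x - V x * v x - 1) (hvi.sub hζi)
      ((hfi.sub hVvi).sub (integrable_const (1 : ℝ))) (fun φ hφ h0 => ?_) ?_
    · have cφ := hφ.continuous
      have cl := continuous_lap_s17 (hφ.of_le two_le_infty)
      have h1 := hv' φ hφ h0
      have h2 := hζeq φ hφ h0
      simp only [zero_mul, add_zero, mul_one, mul_neg, integral_neg] at h2
      have e1 : ∫ x in Ω, (v x - ζ x) * -lap φ x
          = (∫ x in Ω, ζ x * lap φ x) - ∫ x in Ω, v x * lap φ x := by
        rw [← integral_sub (integrable_mul_of_continuous hm hb hζi cl)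
          (integrable_mul_of_continuous hm hb hvi cl)]
        congr 1 with x
        ring
      have e2 : ∫ x in Ω, (f x - V x * v x - 1) * φ x
          = -(∫ x in Ω, (V x * v x - f x) * φ x) - ∫ x in Ω, φ x := by
        have i1 : IntegrableOn (fun x => -((V x * v x - f x) * φ x)) Ω :=
          (integrable_mul_of_continuous hm hb (hVvi.sub hfi) cφ).neg
        rw [← integral_neg, ← integral_sub i1 (integrableOn_of_continuous hb cφ)]
        congr 1 with x
        ring
      linarith
    · filter_upwards [hV0, hf1, hv0] with x hVx hfx hvx _
      nlinarith [mul_nonneg hVx (neg_nonpos.1 hvx)]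
  filter_upwards [hvζ] with x hx using sub_nonpos.1 hx
end
end
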